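/- arXiv:1809.00714 — 2 statements merged into one kernel-verified Lean document; each statement's English description precedes it below -/
import Mathlib

section
/- Uniform boundary estimate: given η > 0, there exist ε₀ > 0 and ε₁ > 0 such that for every y₀ ∈ ∂Ω and every 0 < ε < ε₀, |u_ε(x) − F(y₀)| ≤ η for all x ∈ B_{ε₁}(y₀) ∩ closure(Ω), where u_ε is the ε-stochastic (equivalently ε-mean value) solution with boundary data F, and F is extended to ∂Ω by continuity. -/
open MeasureTheory Metric Set
open scoped ENNReal NNReal Classical

noncomputable section

abbrev EucN (N : ℕ) := EuclideanSpace ℝ (Fin N)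

variable {N : ℕ}

/-- The directional mean value operator `M^ε_ξ v (x)`. -/
def mveOp (q ε : ℝ) (v : EucN N → ℝ) (ξ x : EucN N) : ℝ :=
  q * (⨍ y in ball x ε, v y) + (1 - q) * ((v (x + ε • ξ) + v (x - ε • ξ)) / 2)

/-- The mean value operator `M^ε v (x) = sup_{|ξ|=1} M^ε_ξ v (x)`. -/
def mvOp (q ε : ℝ) (v : EucN N → ℝ) (x : EucN N) : ℝ :=
  ⨆ ξ : sphere (0 : EucN N) 1, mveOp q ε v (ξ : EucN N) x

/-- `Ω_ε = {x : dist(x,Ω) ≤ ε}`. -/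
def Oeps (Ω : Set (EucN N)) (ε : ℝ) : Set (EucN N) := {x | Metric.infDist x Ω ≤ ε}

/-- `Γ_ε = Ω_ε \ closure Ω`. -/
def Geps (Ω : Set (EucN N)) (ε : ℝ) : Set (EucN N) := Oeps Ω ε \ closure Ω

/-- `v` is an `ε`-mean value solution with boundary data `F`. -/
def IsMVS (q ε : ℝ) (Ω : Set (EucN N)) (F v : EucN N → ℝ) : Prop :=
  Measurable v ∧ (∃ C, ∀ x ∈ Oeps Ω ε, |v x| ≤ C) ∧ EqOn v F (Geps Ω ε) ∧
    LowerSemicontinuousOn v (closure Ω) ∧ ∀ x ∈ closure Ω, v x = mvOp q ε v x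

/-- exterior corkscrew condition, satisfied by bounded Lipschitz domains -/
def Corkscrew (Ω : Set (EucN N)) (δbar μ : ℝ) : Prop :=
  ∀ δ, 0 < δ → δ < δbar → ∀ y ∈ frontier Ω, ∃ z, closedBall z (μ * δ) ⊆ ball y δ \ Ω

/-- The Gaussian `exp (-a |x - z|²)` used as a barrier. -/
def gaussBarrier (a : ℝ) (z x : EucN N) : ℝ := Real.exp (-(a * ‖x - z‖ ^ 2))

lemma gaussBarrier_pos (a : ℝ) (z x : EucN N) : 0 < gaussBarrier a z x := Real.exp_pos _

lemma gaussBarrier_le_one {a : ℝ} (ha : 0 ≤ a) (z x : EucN N) : gaussBarrier a z x ≤ 1 := by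
  unfold gaussBarrier
  rw [Real.exp_le_one_iff]
  nlinarith [mul_nonneg ha (sq_nonneg ‖x - z‖)]

lemma continuous_gaussBarrier (a : ℝ) (z : EucN N) : Continuous (gaussBarrier a z) := by
  unfold gaussBarrier
  fun_prop

lemma two_add_sq_div_two_le_exp_add_exp_neg (t : ℝ) :
    2 + t ^ 2 / 2 ≤ Real.exp t + Real.exp (-t) := by
  rcases le_total 0 t with h | h
  · linarith [Real.quadratic_le_exp_of_nonneg h, Real.add_one_le_exp (-t)]
  · nlinarith [Real.quadratic_le_exp_of_nonneg (neg_nonneg.2 h), Real.add_one_le_exp t]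

lemma gaussBarrier_symm_ge {a ε : ℝ} (ha : 0 ≤ a) (haε : a * ε ^ 2 ≤ 1 / 2)
    (z x h : EucN N) (hh : ‖h‖ ≤ ε) :
    gaussBarrier a z x * (1 - a * ε ^ 2 + a ^ 2 * (inner ℝ (x - z) h) ^ 2 / 2) ≤
      (gaussBarrier a z (x + h) + gaussBarrier a z (x - h)) / 2 := by
  set t : ℝ := 2 * a * inner ℝ (x - z) h with ht
  have e1 : gaussBarrier a z (x + h) =
      gaussBarrier a z x * (Real.exp (-(a * ‖h‖ ^ 2)) * Real.exp (-t)) := by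
    unfold gaussBarrier
    rw [← Real.exp_add, ← Real.exp_add, show x + h - z = (x - z) + h by abel, norm_add_sq_real]
    congr 1
    rw [ht]; ring
  have e2 : gaussBarrier a z (x - h) =
      gaussBarrier a z x * (Real.exp (-(a * ‖h‖ ^ 2)) * Real.exp t) := by
    unfold gaussBarrier
    rw [← Real.exp_add, ← Real.exp_add, show x - h - z = (x - z) - h by abel, norm_sub_sq_real]
    congr 1
    rw [ht]; ring
  have hsq : ‖h‖ ^ 2 ≤ ε ^ 2 := pow_le_pow_left₀ (norm_nonneg _) hh 2
  have e3 : 1 - a * ε ^ 2 ≤ Real.exp (-(a * ‖h‖ ^ 2)) := by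
    have := Real.add_one_le_exp (-(a * ‖h‖ ^ 2))
    nlinarith [mul_le_mul_of_nonneg_left hsq ha]
  have e4 := two_add_sq_div_two_le_exp_add_exp_neg t
  have e5 : (1 - a * ε ^ 2) * (2 + t ^ 2 / 2) ≤
      Real.exp (-(a * ‖h‖ ^ 2)) * (Real.exp t + Real.exp (-t)) :=
    mul_le_mul e3 e4 (by positivity) (by positivity)
  have e6 : 1 - a * ε ^ 2 + a ^ 2 * (inner ℝ (x - z) h) ^ 2 / 2 ≤
      Real.exp (-(a * ‖h‖ ^ 2)) * (Real.exp t + Real.exp (-t)) / 2 := by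
    have : t ^ 2 = 4 * (a ^ 2 * (inner ℝ (x - z) h) ^ 2) := by rw [ht]; ring
    rw [this] at e5
    have h0 : 0 ≤ a ^ 2 * (inner ℝ (x - z) h) ^ 2 := by positivity
    nlinarith [mul_nonneg h0 (sub_nonneg.2 haε)]
  rw [e1, e2]
  calc _ ≤ gaussBarrier a z x * (Real.exp (-(a * ‖h‖ ^ 2)) * (Real.exp t + Real.exp (-t)) / 2) :=
        mul_le_mul_of_nonneg_left e6 (gaussBarrier_pos _ _ _).le
    _ = _ := by ring

lemma integrableOn_ball_of_continuous {f : EucN N → ℝ} (hf : Continuous f) (x : EucN N) (r : ℝ) :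
    IntegrableOn f (ball x r) :=
  (hf.continuousOn.integrableOn_compact (isCompact_closedBall x r)).mono_set ball_subset_closedBall

lemma setIntegral_ball_reflect (f : EucN N → ℝ) (x : EucN N) (ε : ℝ) :
    ∫ y in ball x ε, f ((x + x) - y) = ∫ y in ball x ε, f y := by
  rw [← integral_indicator measurableSet_ball, ← integral_indicator measurableSet_ball,
    ← integral_sub_left_eq_self ((ball x ε).indicator f) volume (x + x)]
  congr 1
  ext y
  have : (x + x - y ∈ ball x ε) ↔ y ∈ ball x ε := by
    rw [mem_ball, mem_ball, dist_eq_norm, dist_eq_norm, ← norm_neg]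
    congr! 2
    abel
  by_cases hy : y ∈ ball x ε
  · rw [indicator_of_mem hy, indicator_of_mem (this.2 hy)]
  · rw [indicator_of_notMem hy, indicator_of_notMem (fun h => hy (this.1 h))]

lemma volume_real_ball_div_four [NeZero N] (x y : EucN N) {ε : ℝ} (hε : 0 < ε) :
    volume.real (ball y (ε / 4)) = volume.real (ball x ε) / 4 ^ N := by
  have : Nontrivial (EucN N) := by
    have := Fin.pos_iff_nonempty.1 (Nat.pos_of_ne_zero (NeZero.ne N))
    infer_instance
  rw [measureReal_def, measureReal_def, Measure.addHaar_ball _ _ hε.le,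
    Measure.addHaar_ball _ _ (by positivity), finrank_euclideanSpace_fin,
    ENNReal.toReal_mul, ENNReal.toReal_mul, ENNReal.toReal_ofReal (by positivity),
    ENNReal.toReal_ofReal (by positivity), div_pow]
  ring

lemma average_gaussBarrier_ge [NeZero N] {a ε : ℝ} (ha : 0 ≤ a) (hε : 0 < ε)
    (haε : a * ε ^ 2 ≤ 1 / 2) (z x : EucN N) :
    gaussBarrier a z x * (1 - a * ε ^ 2 + a ^ 2 * ‖x - z‖ ^ 2 * ε ^ 2 / (32 * 4 ^ N)) ≤
      ⨍ y in ball x ε, gaussBarrier a z y := by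
  set G := gaussBarrier a z x with hG
  have hGpos : 0 < G := gaussBarrier_pos a z x
  have hvol : 0 < volume.real (ball x ε) := by
    rw [measureReal_def]
    exact ENNReal.toReal_pos (measure_ball_pos _ _ hε).ne' measure_ball_lt_top.ne
  set A : Set (EucN N) := ball (x + (ε / (2 * ‖x - z‖)) • (x - z)) (ε / 4) with hA
  have hcA : ‖(ε / (2 * ‖x - z‖)) • (x - z)‖ ≤ ε / 2 := by
    rw [norm_smul, Real.norm_of_nonneg (by positivity)]
    rcases eq_or_ne ‖x - z‖ 0 with h0 | h0
    · rw [h0]; simp; positivity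
    · apply le_of_eq; field_simp
  have hAsub : A ⊆ ball x ε := by
    apply ball_subset_ball'
    rw [dist_eq_norm, add_sub_cancel_left]
    linarith
  have hinner : ∀ y ∈ A, ‖x - z‖ * ε / 4 ≤ inner ℝ (x - z) (y - x) := by
    intro y hy
    set e := y - (x + (ε / (2 * ‖x - z‖)) • (x - z)) with he
    have hen : ‖e‖ ≤ ε / 4 := by
      rw [hA, mem_ball, dist_eq_norm] at hy
      exact hy.le
    have : y - x = (ε / (2 * ‖x - z‖)) • (x - z) + e := by rw [he]; abel
    rw [this, inner_add_right, inner_smul_right, real_inner_self_eq_norm_sq]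
    have h1 : ε / (2 * ‖x - z‖) * ‖x - z‖ ^ 2 = ε / 2 * ‖x - z‖ := by
      rcases eq_or_ne ‖x - z‖ 0 with h0 | h0
      · rw [h0]; simp
      · field_simp
    have h2 := (abs_le.1 (abs_real_inner_le_norm (x - z) e)).1
    rw [h1]
    nlinarith [mul_le_mul_of_nonneg_left hen (norm_nonneg (x - z))]
  have hcont := continuous_gaussBarrier a z
  have hi1 := integrableOn_ball_of_continuous hcont x ε
  have hi2 : IntegrableOn (fun y => gaussBarrier a z ((x + x) - y)) (ball x ε) :=
    integrableOn_ball_of_continuous (hcont.comp (by fun_prop)) x ε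
  set c : ℝ := a ^ 2 * (‖x - z‖ * ε / 4) ^ 2 / 2 with hc
  have hpt : ∀ y ∈ ball x ε, G * (1 - a * ε ^ 2) + A.indicator (fun _ => G * c) y ≤
      (gaussBarrier a z y + gaussBarrier a z ((x + x) - y)) / 2 := by
    intro y hy
    have hyn : ‖y - x‖ ≤ ε := by rw [← dist_eq_norm]; exact (mem_ball.1 hy).le
    have key := gaussBarrier_symm_ge ha haε z x (y - x) hyn
    rw [show x + (y - x) = y by abel, show x - (y - x) = (x + x) - y by abel] at key
    refine le_trans ?_ key
    have hle : A.indicator (fun _ => G * c) y ≤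
        G * (a ^ 2 * (inner ℝ (x - z) (y - x)) ^ 2 / 2) := by
      by_cases hyA : y ∈ A
      · rw [indicator_of_mem hyA, hc]
        have := pow_le_pow_left₀ (by positivity) (hinner y hyA) 2
        gcongr
      · rw [indicator_of_notMem hyA]
        positivity
    calc _ ≤ G * (1 - a * ε ^ 2) + G * (a ^ 2 * (inner ℝ (x - z) (y - x)) ^ 2 / 2) := by gcongr
      _ = _ := by ring
  have hiA : IntegrableOn (A.indicator (fun _ => G * c)) (ball x ε) := by
    apply IntegrableOn.indicator _ measurableSet_ball
    exact integrableOn_const (measure_ball_lt_top.ne)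
  have hic : IntegrableOn (fun _ : EucN N => G * (1 - a * ε ^ 2)) (ball x ε) :=
    integrableOn_const (measure_ball_lt_top.ne)
  have hmono := setIntegral_mono_on (hic.add hiA) ((hi1.add hi2).div_const 2)
    measurableSet_ball hpt
  have hR : ∫ y in ball x ε, (gaussBarrier a z y + gaussBarrier a z ((x + x) - y)) / 2 =
      ∫ y in ball x ε, gaussBarrier a z y := by
    rw [integral_div, integral_add hi1 hi2, setIntegral_ball_reflect]
    ring
  have hL : ∫ y in ball x ε, (G * (1 - a * ε ^ 2) + A.indicator (fun _ => G * c) y) =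
      volume.real (ball x ε) * (G * (1 - a * ε ^ 2)) +
        volume.real (ball x ε) / 4 ^ N * (G * c) := by
    rw [integral_add hic hiA, setIntegral_indicator measurableSet_ball,
      inter_eq_self_of_subset_right hAsub, setIntegral_const, setIntegral_const, hA,
      volume_real_ball_div_four x _ hε, smul_eq_mul, smul_eq_mul]
  rw [setAverage_eq, smul_eq_mul, inv_mul_eq_div, le_div_iff₀ hvol, ← hR]
  refine le_trans (le_of_eq ?_) hmono
  refine Eq.trans ?_ hL.symm
  rw [hc]
  field_simp
  ring

/-- The Gaussian barrier is strictly increased by every directional mean value operator away from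
its centre. -/
lemma mveOp_gaussBarrier_ge [NeZero N] {q a ε ρ : ℝ} (hq0 : 0 < q) (hq1 : q ≤ 1) (hρ : 0 < ρ)
    (haρ : 64 * 4 ^ N ≤ q * a * ρ ^ 2) (ha : 0 ≤ a) (hε : 0 < ε) (haε : a * ε ^ 2 ≤ 1 / 2)
    {z x ξ : EucN N} (hξ : ‖ξ‖ = 1) (hx : ρ ≤ ‖x - z‖) :
    gaussBarrier a z x * (1 + a * ε ^ 2) ≤ mveOp q ε (gaussBarrier a z) ξ x := by
  have h1 := average_gaussBarrier_ge ha hε haε z x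
  have h2 := gaussBarrier_symm_ge ha haε z x (ε • ξ)
    (by rw [norm_smul, hξ, Real.norm_of_nonneg hε.le, mul_one])
  have hG := gaussBarrier_pos a z x
  have h3 : gaussBarrier a z x * (1 - a * ε ^ 2) ≤
      (gaussBarrier a z (x + ε • ξ) + gaussBarrier a z (x - ε • ξ)) / 2 := by
    refine le_trans (mul_le_mul_of_nonneg_left ?_ hG.le) h2
    have : 0 ≤ a ^ 2 * (inner ℝ (x - z) (ε • ξ)) ^ 2 / 2 := by positivity
    linarith
  unfold mveOp
  refine le_trans ?_ (add_le_add (mul_le_mul_of_nonneg_left h1 hq0.le)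
    (mul_le_mul_of_nonneg_left h3 (sub_nonneg.2 hq1)))
  have h4 : 64 * 4 ^ N ≤ q * a * ‖x - z‖ ^ 2 := haρ.trans (by gcongr)
  have h5 : 2 * (a * ε ^ 2) ≤ q * (a ^ 2 * ‖x - z‖ ^ 2 * ε ^ 2 / (32 * 4 ^ N)) := by
    rw [← mul_div_assoc, le_div_iff₀ (by positivity)]
    nlinarith [mul_le_mul_of_nonneg_left h4 (by positivity : 0 ≤ a * ε ^ 2)]
  nlinarith [mul_le_mul_of_nonneg_left h5 hG.le]

/-- `w` is a bounded `ε`-mean value subsolution. -/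
def IsSubMVS (q ε : ℝ) (Ω : Set (EucN N)) (w : EucN N → ℝ) : Prop :=
  Measurable w ∧ (∃ C, ∀ x ∈ Oeps Ω ε, |w x| ≤ C) ∧
    ∀ x ∈ closure Ω, ∀ τ > 0, ∃ ξ : EucN N, ‖ξ‖ = 1 ∧ w x ≤ mveOp q ε w ξ x + τ

lemma closedBall_subset_Oeps {Ω : Set (EucN N)} {ε : ℝ} {x : EucN N} (hx : x ∈ closure Ω) :
    closedBall x ε ⊆ Oeps Ω ε := by
  intro y hy
  have h : infDist y (closure Ω) ≤ dist y x := infDist_le_dist_of_mem hx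
  rw [infDist_closure] at h
  exact h.trans hy

lemma closure_subset_Oeps {Ω : Set (EucN N)} {ε : ℝ} (hε : 0 < ε) : closure Ω ⊆ Oeps Ω ε :=
  fun _ hx => closedBall_subset_Oeps hx (mem_closedBall_self hε.le)

lemma add_smul_mem_closedBall {ε : ℝ} (hε : 0 < ε) {x ξ : EucN N} (hξ : ‖ξ‖ = 1) :
    x + ε • ξ ∈ closedBall x ε ∧ x - ε • ξ ∈ closedBall x ε := by
  simp [mem_closedBall, dist_eq_norm, norm_smul, hξ, abs_of_pos hε]

lemma integrableOn_ball_of_bounded {Ω : Set (EucN N)} {ε : ℝ} {w : EucN N → ℝ}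
    (hw : Measurable w) {C : ℝ} (hC : ∀ x ∈ Oeps Ω ε, |w x| ≤ C) {x : EucN N}
    (hx : x ∈ closure Ω) : IntegrableOn w (ball x ε) := by
  refine IntegrableOn.of_bound measure_ball_lt_top hw.aestronglyMeasurable C ?_
  filter_upwards [ae_restrict_mem measurableSet_ball] with y hy
  exact hC y (closedBall_subset_Oeps hx (ball_subset_closedBall hy))

lemma mveOp_mono {q ε : ℝ} (hq0 : 0 < q) (hq1 : q ≤ 1) (hε : 0 < ε) {f g : EucN N → ℝ}
    {x ξ : EucN N} (hξ : ‖ξ‖ = 1) (hf : IntegrableOn f (ball x ε)) (hg : IntegrableOn g (ball x ε))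
    (hfg : ∀ y ∈ closedBall x ε, f y ≤ g y) : mveOp q ε f ξ x ≤ mveOp q ε g ξ x := by
  have h1 : ⨍ y in ball x ε, f y ≤ ⨍ y in ball x ε, g y := by
    rw [setAverage_eq, setAverage_eq, smul_eq_mul, smul_eq_mul]
    have := setIntegral_mono_on hf hg measurableSet_ball
      (fun y hy => hfg y (ball_subset_closedBall hy))
    gcongr
  obtain ⟨hp, hm⟩ := add_smul_mem_closedBall (x := x) hε hξ
  have h2 := hfg _ hp
  have h3 := hfg _ hm
  have h4 : 0 ≤ 1 - q := sub_nonneg.2 hq1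
  unfold mveOp
  gcongr

lemma mveOp_const_sub_mul {q ε b C : ℝ} (hε : 0 < ε) {g : EucN N → ℝ} {x ξ : EucN N}
    (hg : IntegrableOn g (ball x ε)) :
    mveOp q ε (fun y => b - C * g y) ξ x = b - C * mveOp q ε g ξ x := by
  have hvol : volume.real (ball x ε) ≠ 0 := by
    rw [measureReal_def]
    exact (ENNReal.toReal_pos (measure_ball_pos _ _ hε).ne' measure_ball_lt_top.ne).ne'
  have hb : IntegrableOn (fun _ : EucN N => b) (ball x ε) :=
    integrableOn_const measure_ball_lt_top.ne
  have : ⨍ y in ball x ε, (b - C * g y) = b - C * ⨍ y in ball x ε, g y := by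
    rw [setAverage_eq, setAverage_eq,
      integral_sub hb (hg.const_mul C),
      integral_const_mul, setIntegral_const, smul_eq_mul, smul_eq_mul, smul_eq_mul]
    field_simp
  unfold mveOp
  rw [this]
  ring

lemma mveOp_neg (q ε : ℝ) (v : EucN N → ℝ) (ξ x : EucN N) :
    mveOp q ε (fun y => -v y) ξ x = -mveOp q ε v ξ x := by
  unfold mveOp
  rw [setAverage_eq, setAverage_eq, integral_neg]
  simp only [smul_eq_mul]
  ring

lemma bddAbove_range_mveOp {q ε : ℝ} (hq1 : q ≤ 1) (hε : 0 < ε)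
    {Ω : Set (EucN N)} {v : EucN N → ℝ} {C : ℝ} (hC : ∀ x ∈ Oeps Ω ε, |v x| ≤ C)
    {x : EucN N} (hx : x ∈ closure Ω) :
    BddAbove (range fun ξ : sphere (0 : EucN N) 1 => mveOp q ε v (ξ : EucN N) x) := by
  refine ⟨q * (⨍ y in ball x ε, v y) + (1 - q) * ((C + C) / 2), ?_⟩
  rintro _ ⟨ξ, rfl⟩
  obtain ⟨hp, hm⟩ := add_smul_mem_closedBall (x := x) hε (mem_sphere_zero_iff_norm.1 ξ.2)
  have h2 := (abs_le.1 (hC _ (closedBall_subset_Oeps hx hp))).2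
  have h3 := (abs_le.1 (hC _ (closedBall_subset_Oeps hx hm))).2
  have h4 : 0 ≤ 1 - q := sub_nonneg.2 hq1
  simp only [mveOp]
  gcongr

lemma IsMVS.isSubMVS [NeZero N] {q ε : ℝ} {Ω : Set (EucN N)} {F v : EucN N → ℝ}
    (hv : IsMVS q ε Ω F v) : IsSubMVS q ε Ω v := by
  obtain ⟨hm, hb, -, -, heq⟩ := hv
  refine ⟨hm, hb, fun x hx τ hτ => ?_⟩
  have : Nonempty (Fin N) := Fin.pos_iff_nonempty.1 (Nat.pos_of_ne_zero (NeZero.ne N))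
  have : Nonempty (sphere (0 : EucN N) 1) := (NormedSpace.sphere_nonempty.2 zero_le_one).to_subtype
  obtain ⟨ξ, hξ⟩ := exists_lt_of_lt_ciSup
    (show mvOp q ε v x - τ < ⨆ ξ : sphere (0 : EucN N) 1, mveOp q ε v (ξ : EucN N) x from
      sub_lt_self _ hτ)
  exact ⟨ξ, mem_sphere_zero_iff_norm.1 ξ.2, by rw [heq x hx]; linarith⟩

lemma IsMVS.isSubMVS_neg [NeZero N] {q ε : ℝ} (hq1 : q ≤ 1) (hε : 0 < ε) {Ω : Set (EucN N)}
    {F v : EucN N → ℝ} (hv : IsMVS q ε Ω F v) : IsSubMVS q ε Ω (fun x => -v x) := by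
  obtain ⟨hm, ⟨C, hC⟩, -, -, heq⟩ := hv
  refine ⟨hm.neg, ⟨C, fun x hx => by rw [abs_neg]; exact hC x hx⟩, fun x hx τ hτ => ?_⟩
  have : Nonempty (Fin N) := Fin.pos_iff_nonempty.1 (Nat.pos_of_ne_zero (NeZero.ne N))
  obtain ⟨ξ, hξ⟩ : (sphere (0 : EucN N) 1).Nonempty := NormedSpace.sphere_nonempty.2 zero_le_one
  refine ⟨ξ, mem_sphere_zero_iff_norm.1 hξ, ?_⟩
  have := le_ciSup (bddAbove_range_mveOp hq1 hε hC hx) ⟨ξ, hξ⟩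
  change mveOp q ε v ξ x ≤ mvOp q ε v x at this
  rw [← heq x hx] at this
  rw [mveOp_neg]
  linarith

/-- Comparison of a subsolution with a Gaussian barrier on a subset `D` of `closure Ω`. -/
lemma IsSubMVS.le_barrier [NeZero N] {q a ε ρ R b C : ℝ} (hq0 : 0 < q) (hq1 : q ≤ 1)
    (hρ : 0 < ρ) (haρ : 64 * 4 ^ N ≤ q * a * ρ ^ 2) (ha : 0 < a) (hε : 0 < ε)
    (haε : a * ε ^ 2 ≤ 1 / 2) (hC : 0 < C) {Ω D : Set (EucN N)} {w : EucN N → ℝ}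
    (hw : IsSubMVS q ε Ω w) {z : EucN N} (hD : D ⊆ closure Ω)
    (hDρ : ∀ x ∈ D, ρ ≤ ‖x - z‖) (hDR : ∀ x ∈ D, ‖x - z‖ ≤ R)
    (hout : ∀ d ∈ D, ∀ x ∈ closedBall d ε, x ∉ D → w x ≤ b - C * gaussBarrier a z x) :
    ∀ x ∈ D, w x ≤ b - C * gaussBarrier a z x := by
  obtain ⟨hm, ⟨B, hB⟩, hsub⟩ := hw
  by_contra! hcon
  obtain ⟨x₀, hx₀, hlt⟩ := hcon
  set f : EucN N → ℝ := fun x => w x - (b - C * gaussBarrier a z x) with hf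
  have hbdd : BddAbove (f '' D) := by
    refine ⟨B - b + C * 1, ?_⟩
    rintro _ ⟨x, hx, rfl⟩
    have h1 := (abs_le.1 (hB x (closure_subset_Oeps hε (hD hx)))).2
    have h2 := mul_le_mul_of_nonneg_left (gaussBarrier_le_one ha.le z x) hC.le
    simp only [hf]
    linarith
  set m := sSup (f '' D) with hmdef
  have hle : ∀ x ∈ D, f x ≤ m := fun x hx => le_csSup hbdd (mem_image_of_mem f hx)
  have hmpos : 0 < m := by
    have := hle x₀ hx₀
    simp only [hf] at this
    linarith
  set κ : ℝ := C * (Real.exp (-(a * R ^ 2)) * (a * ε ^ 2)) with hκ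
  have hκpos : 0 < κ := by positivity
  have himp : ∀ x ∈ D, f x ≤ m - κ / 2 := by
    intro x hx
    obtain ⟨ξ, hξ, hwx⟩ := hsub x (hD hx) (κ / 2) (by positivity)
    have hgi := integrableOn_ball_of_continuous (continuous_gaussBarrier a z) x ε
    have h1 : mveOp q ε w ξ x ≤ mveOp q ε (fun y => (b + m) - C * gaussBarrier a z y) ξ x := by
      refine mveOp_mono hq0 hq1 hε hξ (integrableOn_ball_of_bounded hm hB (hD hx))
        ((integrableOn_const measure_ball_lt_top.ne).sub (hgi.const_mul C)) fun y hy => ?_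
      by_cases hyD : y ∈ D
      · have := hle y hyD
        simp only [hf] at this
        linarith
      · linarith [hout x hx y hy hyD]
    rw [mveOp_const_sub_mul hε hgi] at h1
    have h2 := mul_le_mul_of_nonneg_left
      (mveOp_gaussBarrier_ge hq0 hq1 hρ haρ ha.le hε haε hξ (hDρ x hx)) hC.le
    have h3 : κ ≤ C * (gaussBarrier a z x * (a * ε ^ 2)) := by
      have := hDR x hx
      rw [hκ, gaussBarrier]
      gcongr
    simp only [hf]
    linarith
  have : m ≤ m - κ / 2 := csSup_le ⟨f x₀, mem_image_of_mem f hx₀⟩ (by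
    rintro _ ⟨x, hx, rfl⟩
    exact himp x hx)
  linarith

lemma mem_Oeps_norm_sub_ge {Ω : Set (EucN N)} (hΩ : Ω.Nonempty) {ε ρ : ℝ} {z x : EucN N}
    (hz : ∀ y ∈ Ω, ρ ≤ ‖y - z‖) (hx : x ∈ Oeps Ω ε) : ρ - ε ≤ ‖x - z‖ := by
  have h1 : ρ ≤ infDist z Ω := (le_infDist hΩ).2 fun y hy => by
    rw [dist_comm, dist_eq_norm]; exact hz y hy
  have h2 : infDist z Ω ≤ infDist x Ω + dist z x := infDist_le_infDist_add_dist
  have h3 : infDist x Ω ≤ ε := hx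
  rw [dist_comm, dist_eq_norm] at h2
  linarith

/-- A subsolution is bounded by its boundary values, up to an additive constant. -/
lemma IsSubMVS.le_of_boundary_le [NeZero N] {q a ε R b : ℝ} (hq0 : 0 < q) (hq1 : q ≤ 1)
    (haq : 64 * 4 ^ N ≤ q * a) (ha : 0 < a) (hε : 0 < ε) (haε : a * ε ^ 2 ≤ 1 / 2)
    {Ω : Set (EucN N)} (hR : 0 ≤ R) (hΩR : closure Ω ⊆ closedBall 0 R) {w : EucN N → ℝ}
    (hw : IsSubMVS q ε Ω w) (hb : ∀ x ∈ Geps Ω ε, w x ≤ b) :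
    ∀ x ∈ Oeps Ω ε, w x ≤ b + 1 := by
  have : Nonempty (Fin N) := Fin.pos_iff_nonempty.1 (Nat.pos_of_ne_zero (NeZero.ne N))
  obtain ⟨z, hz⟩ := exists_norm_eq (EucN N) (show (0 : ℝ) ≤ R + 1 by positivity)
  have hn : ∀ x ∈ closure Ω, ‖x‖ ≤ R := fun x hx => mem_closedBall_zero_iff.1 (hΩR hx)
  have key := hw.le_barrier (D := closure Ω) (z := z) (ρ := 1) (R := 2 * R + 1) (b := b + 1)
    (C := 1) hq0 hq1 one_pos (by simpa using haq) ha hε haε one_pos subset_rfl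
    (fun x hx => by
      have := norm_sub_norm_le z x
      rw [norm_sub_rev] at this
      linarith [hn x hx])
    (fun x hx => by linarith [hn x hx, norm_sub_le x z])
    (fun d hd x hx hxD => by
      have := hb x ⟨closedBall_subset_Oeps hd hx, hxD⟩
      linarith [gaussBarrier_le_one ha.le z x])
  intro x hx
  by_cases hxc : x ∈ closure Ω
  · linarith [key x hxc, gaussBarrier_pos a z x]
  · linarith [hb x ⟨hx, hxc⟩]

/-- The factor by which the oscillation at the boundary decreases when the radius is divided
by five. -/
def decayFactor (α μ : ℝ) : ℝ :=
  (Real.exp (-(α * (μ / 2) ^ 2)) - Real.exp (-(α * 2 ^ 2))) /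
    (Real.exp (-(α * (μ / 2) ^ 2)) - Real.exp (-(α * 3 ^ 2)))

lemma exp_neg_mul_sq_lt {α s t : ℝ} (hα : 0 < α) (hs : 0 ≤ s) (hst : s < t) :
    Real.exp (-(α * t ^ 2)) < Real.exp (-(α * s ^ 2)) := by
  gcongr

lemma decayFactor_mem {α μ : ℝ} (hα : 0 < α) (hμ : μ ∈ Ioo (0 : ℝ) 1) :
    decayFactor α μ ∈ Ioo (0 : ℝ) 1 := by
  have h0 := hμ.1
  have h1 := exp_neg_mul_sq_lt (s := μ / 2) (t := 2) hα (by positivity) (by linarith [hμ.2])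
  have h2 := exp_neg_mul_sq_lt (s := 2) (t := 3) hα (by norm_num) (by norm_num)
  refine ⟨div_pos (sub_pos.2 h1) (sub_pos.2 (h2.trans h1)), ?_⟩
  rw [decayFactor, div_lt_one (sub_pos.2 (h2.trans h1))]
  exact sub_lt_sub_left h2 _

/-- Decay of a subsolution near a boundary point, passing from radius `5 δ` to radius `δ`. -/
lemma IsSubMVS.decay [NeZero N] {q ε α μ δ β m : ℝ} (hq0 : 0 < q) (hq1 : q ≤ 1)
    (hμ : μ ∈ Ioo (0 : ℝ) 1) (hα : 0 < α) (hαq : 64 * 4 ^ N ≤ q * α * μ ^ 2) (hε : 0 < ε)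
    (hδ : 0 < δ) (hεδ : ε ≤ μ / 2 * δ) (hαε : α / δ ^ 2 * ε ^ 2 ≤ 1 / 2) (hm : 0 < m)
    {Ω : Set (EucN N)} (hΩ : Ω.Nonempty) {y₀ z : EucN N}
    (hz : closedBall z (μ * δ) ⊆ ball y₀ δ \ Ω) {w : EucN N → ℝ} (hw : IsSubMVS q ε Ω w)
    (hb : ∀ x ∈ Geps Ω ε, x ∈ closedBall y₀ (5 * δ) → w x ≤ β)
    (h5 : ∀ x ∈ Oeps Ω ε, x ∈ closedBall y₀ (5 * δ) → w x ≤ β + m) :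
    ∀ x ∈ Oeps Ω ε, x ∈ closedBall y₀ δ → w x ≤ β + decayFactor α μ * m := by
  have hμ0 := hμ.1
  have hμδ : 0 < μ * δ := by positivity
  have hε' : ε ≤ δ := by nlinarith [hμ.2]
  set P := Real.exp (-(α * (μ / 2) ^ 2)) with hP
  set Q := Real.exp (-(α * 2 ^ 2)) with hQ
  set S := Real.exp (-(α * 3 ^ 2)) with hS
  have hPQ : Q < P := exp_neg_mul_sq_lt hα (by positivity) (by linarith [hμ.2])
  have hQS : S < Q := exp_neg_mul_sq_lt hα (by norm_num) (by norm_num)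
  have hPS : 0 < P - S := by linarith
  have hθ := (decayFactor_mem hα hμ).1
  have hθeq : decayFactor α μ = (P - Q) / (P - S) := rfl
  set a := α / δ ^ 2 with ha
  have hapos : 0 < a := by positivity
  have hscale : ∀ t : ℝ, α * t ^ 2 = a * (t * δ) ^ 2 := fun t => by rw [ha]; field_simp
  have hΩz : ∀ y ∈ Ω, μ * δ ≤ ‖y - z‖ := by
    intro y hy
    by_contra! hlt
    exact (hz (show y ∈ closedBall z (μ * δ) by
      rw [mem_closedBall, dist_eq_norm]; exact hlt.le)).2 hy
  have hOz : ∀ x ∈ Oeps Ω ε, μ / 2 * δ ≤ ‖x - z‖ := fun x hx => by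
    linarith [mem_Oeps_norm_sub_ge hΩ hΩz hx]
  have hcl : ∀ x ∈ closure Ω, μ * δ ≤ ‖x - z‖ := by
    refine fun x hx => closure_minimal (t := {x | μ * δ ≤ ‖x - z‖}) hΩz ?_ hx
    exact isClosed_le continuous_const (by fun_prop)
  have hzy : dist z y₀ < δ := (hz (mem_closedBall_self hμδ.le)).1
  have hGP : ∀ x ∈ Oeps Ω ε, gaussBarrier a z x ≤ P := by
    intro x hx
    have := hOz x hx
    rw [hP, hscale, gaussBarrier]
    gcongr
  have hGS : ∀ x, 4 * δ < dist x y₀ → gaussBarrier a z x ≤ S := by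
    intro x hx
    have h3 : 3 * δ ≤ ‖x - z‖ := by
      rw [← dist_eq_norm]; linarith [dist_triangle x z y₀]
    rw [hS, hscale, gaussBarrier]
    gcongr
  have hGQ : ∀ x ∈ closedBall y₀ δ, Q ≤ gaussBarrier a z x := by
    intro x hx
    have h2 : ‖x - z‖ ≤ 2 * δ := by
      rw [← dist_eq_norm]; linarith [dist_triangle_right x z y₀, mem_closedBall.1 hx]
    rw [hQ, hscale, gaussBarrier]
    gcongr
  have hC : 0 < m / (P - S) := by positivity
  have hCPS : m / (P - S) * (P - S) = m := by field_simp
  have key := hw.le_barrier (D := closure Ω ∩ closedBall y₀ (4 * δ)) (z := z) (ρ := μ * δ)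
    (R := 5 * δ) (a := a) (b := β + m / (P - S) * P) (C := m / (P - S)) hq0 hq1 hμδ
    (hαq.trans (le_of_eq (by rw [mul_assoc, hscale]; ring))) hapos hε hαε hC inter_subset_left
    (fun x hx => hcl x hx.1)
    (fun x hx => by
      rw [← dist_eq_norm]
      linarith [dist_triangle_right x z y₀, mem_closedBall.1 hx.2])
    (fun d hd x hx hxD => by
      have hxO := closedBall_subset_Oeps hd.1 hx
      have hx5 : x ∈ closedBall y₀ (5 * δ) := by
        rw [mem_closedBall] at hx ⊢
        linarith [dist_triangle x d y₀, mem_closedBall.1 hd.2]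
      by_cases hxc : x ∈ closure Ω
      · have hx4 : 4 * δ < dist x y₀ := by
          by_contra! hle
          exact hxD ⟨hxc, hle⟩
        have := mul_le_mul_of_nonneg_left (hGS x hx4) hC.le
        linarith [h5 x hxO hx5]
      · have := mul_le_mul_of_nonneg_left (hGP x hxO) hC.le
        linarith [hb x ⟨hxO, hxc⟩ hx5])
  intro x hxO hx
  by_cases hxc : x ∈ closure Ω
  · have h4 := key x ⟨hxc, closedBall_subset_closedBall (by linarith) hx⟩
    have := mul_le_mul_of_nonneg_left (hGQ x hx) hC.le
    have hfin : m / (P - S) * (P - Q) = (P - Q) / (P - S) * m := by ring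
    rw [hθeq, ← hfin]
    linarith
  · have := hb x ⟨hxO, hxc⟩ (closedBall_subset_closedBall (by linarith) hx)
    linarith [mul_pos hθ hm]

/-- One-sided uniform boundary estimate for subsolutions. -/
lemma exists_boundary_upper_bound [NeZero N] {q : ℝ} (hq0 : 0 < q) (hq1 : q ≤ 1)
    {Ω : Set (EucN N)} (hΩb : Bornology.IsBounded Ω) (hΩ : Ω.Nonempty) (hΩo : IsOpen Ω)
    {δbar μ : ℝ} (hδbar : 0 < δbar) (hμ : μ ∈ Ioo (0 : ℝ) 1) (hcork : Corkscrew Ω δbar μ)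
    (K : ℝ≥0) {η : ℝ} (hη : 0 < η) :
    ∃ ε₀ > 0, ∃ ε₁ > 0, ∀ F : EucN N → ℝ, LipschitzOnWith K F Ωᶜ → ∀ y₀ ∈ frontier Ω,
      ∀ ε : ℝ, 0 < ε → ε < ε₀ → ∀ w : EucN N → ℝ, IsSubMVS q ε Ω w → EqOn w F (Geps Ω ε) →
        ∀ x ∈ ball y₀ ε₁ ∩ closure Ω, w x ≤ F y₀ + η := by
  have hμ0 := hμ.1
  obtain ⟨R₀, hR₀⟩ := hΩb.closure.subset_closedBall (0 : EucN N)
  set R := max R₀ 0 with hRdef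
  have hR : 0 ≤ R := le_max_right _ _
  have hΩR : closure Ω ⊆ closedBall 0 R :=
    hR₀.trans (closedBall_subset_closedBall (le_max_left _ _))
  set α : ℝ := 64 * 4 ^ N / (q * μ ^ 2) with hα
  have hαpos : 0 < α := by positivity
  have hαq : 64 * 4 ^ N ≤ q * α * μ ^ 2 := le_of_eq (by rw [hα]; field_simp)
  have hαq' : 64 * 4 ^ N ≤ q * α := hαq.trans
    (mul_le_of_le_one_right (by positivity) (pow_le_one₀ hμ0.le hμ.2.le))
  obtain ⟨hθ0, hθ1⟩ := decayFactor_mem hαpos hμ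
  set θ := decayFactor α μ with hθ
  set m₀ : ℝ := K * (2 * R + 2) + 1 with hm₀
  have hm₀pos : 0 < m₀ := by positivity
  set δ₀ : ℝ := min (δbar / 2) (η / (2 * (K + 1))) with hδ₀
  have hδ₀pos : 0 < δ₀ := by positivity
  have hKδ₀ : K * δ₀ ≤ η / 2 := by
    have h1 : δ₀ ≤ η / (2 * (K + 1)) := min_le_right _ _
    rw [le_div_iff₀ (by positivity)] at h1
    nlinarith
  set τ : ℝ := min (μ / 2) (1 / (2 * α + 1)) with hτ
  have hτpos : 0 < τ := by positivity
  have hτ1 : τ ≤ 1 := (min_le_left _ _).trans (by linarith [hμ.2])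
  have hατ : α * τ ^ 2 ≤ 1 / 2 := by
    have h1 : τ ≤ 1 / (2 * α + 1) := min_le_right _ _
    rw [le_div_iff₀ (by positivity)] at h1
    nlinarith [mul_le_mul_of_nonneg_left hτ1 (mul_pos hαpos hτpos).le]
  obtain ⟨n, hn⟩ := exists_pow_lt_of_lt_one (show 0 < η / (2 * m₀) by positivity) hθ1
  have hn' : θ ^ n * m₀ ≤ η / 2 := by
    rw [lt_div_iff₀ (by positivity)] at hn
    linarith
  refine ⟨min 1 (min τ (τ * (δ₀ / 5 ^ n))), by positivity, δ₀ / 5 ^ n, by positivity, ?_⟩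
  intro F hF y₀ hy₀ ε hε hεlt w hw hwF x hx
  obtain ⟨hε1, hετ, hεn⟩ : ε < 1 ∧ ε < τ ∧ ε < τ * (δ₀ / 5 ^ n) := by
    simpa only [lt_min_iff] using hεlt
  have hy₀c : y₀ ∈ closure Ω := frontier_subset_closure hy₀
  have hy₀n : y₀ ∈ Ωᶜ := by
    rw [hΩo.frontier_eq] at hy₀
    exact hy₀.2
  have hFle : ∀ y ∈ Geps Ω ε, w y ≤ F y₀ + K * dist y y₀ := by
    intro y hy
    rw [hwF hy]
    have := hF.dist_le_mul y (fun h => hy.2 (subset_closure h)) y₀ hy₀n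
    rw [Real.dist_eq] at this
    linarith [le_abs_self (F y - F y₀)]
  have hglob : ∀ y ∈ Oeps Ω ε, w y ≤ F y₀ + K * (2 * R + 2) + 1 := by
    refine hw.le_of_boundary_le (a := α) hq0 hq1 hαq' hαpos hε ?_ hR hΩR fun y hy => ?_
    · exact le_trans (by gcongr) hατ
    · refine (hFle y hy).trans ?_
      obtain ⟨y', hy', hd⟩ := (infDist_lt_iff hΩ).1 (show infDist y Ω < 2 from
        lt_of_le_of_lt hy.1 (by linarith))
      have h1 := mem_closedBall.1 (hΩR (subset_closure hy'))
      have h2 := mem_closedBall.1 (hΩR hy₀c)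
      have h3 := dist_triangle y y' y₀
      have h4 := dist_triangle_right y' y₀ 0
      have : dist y y₀ ≤ 2 * R + 2 := by linarith
      gcongr
  have hiter : ∀ k ≤ n, ∀ y ∈ Oeps Ω ε, y ∈ closedBall y₀ (δ₀ / 5 ^ k) →
      w y ≤ F y₀ + η / 2 + θ ^ k * m₀ := by
    intro k
    induction k with
    | zero =>
      intro _ y hy _
      rw [pow_zero, one_mul]
      linarith [hglob y hy]
    | succ k ih =>
      intro hk
      set δ := δ₀ / 5 ^ (k + 1) with hδ
      have hδpos : 0 < δ := by positivity
      have h5 : 5 * δ = δ₀ / 5 ^ k := by rw [hδ, pow_succ]; field_simp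
      have h5le : 5 * δ ≤ δ₀ := by
        rw [h5]
        exact div_le_self hδ₀pos.le (one_le_pow₀ (by norm_num))
      have hεδ : ε ≤ τ * δ := by
        refine hεn.le.trans ?_
        rw [hδ]
        gcongr
        norm_num
      obtain ⟨z, hz⟩ := hcork δ hδpos
        (by linarith [min_le_left (δbar / 2) (η / (2 * ((K : ℝ) + 1)))]) y₀ hy₀
      have hα' : α / δ ^ 2 * ε ^ 2 ≤ 1 / 2 := by
        calc α / δ ^ 2 * ε ^ 2 ≤ α / δ ^ 2 * (τ * δ) ^ 2 := by gcongr
          _ = α * τ ^ 2 := by field_simp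
          _ ≤ 1 / 2 := hατ
      have key := hw.decay (β := F y₀ + η / 2) (m := θ ^ k * m₀) hq0 hq1 hμ hαpos hαq hε hδpos
        (hεδ.trans (mul_le_mul_of_nonneg_right (min_le_left _ _) hδpos.le)) hα'
        (by positivity) hΩ hz
        (fun y hy hy5 => by
          have h1 : (K : ℝ) * dist y y₀ ≤ K * δ₀ := by
            gcongr
            exact (mem_closedBall.1 hy5).trans h5le
          linarith [hFle y hy])
        (by rw [h5]; exact ih (by omega))
      intro y hy hyδ
      have := key y hy hyδ
      rw [pow_succ]
      linarith
  have := hiter n le_rfl x (closure_subset_Oeps hε hx.2) (ball_subset_closedBall hx.1)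
  linarith

/-- uniform boundary estimate: given `η > 0` there are `ε₀ > 0` and
`ε₁ > 0` such that `|u_ε(x) − F(y₀)| ≤ η` for all `y₀ ∈ ∂Ω`, all `0 < ε < ε₀`, and
all `x ∈ B_{ε₁}(y₀) ∩ closure Ω`. -/
theorem boundary_estimate (hN : 2 ≤ N) (p q : ℝ) (hp : 2 ≤ p)
    (hq : q = ((N : ℝ) + 2) / ((N : ℝ) + p))
    (Ω : Set (EucN N)) (hΩo : IsOpen Ω) (hΩb : Bornology.IsBounded Ω)
    (hΩc : IsConnected Ω) (δbar μ : ℝ) (hδbar : 0 < δbar) (hμ : μ ∈ Ioo (0 : ℝ) 1)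
    (hΩlip : Corkscrew Ω δbar μ)
    (F : EucN N → ℝ) (K : ℝ≥0) (hF : LipschitzOnWith K F Ωᶜ)
    (u : ℝ → EucN N → ℝ) (hu : ∀ ε : ℝ, 0 < ε → IsMVS q ε Ω F (u ε))
    (η : ℝ) (hη : 0 < η) :
    ∃ ε₀ > 0, ∃ ε₁ > 0, ∀ y₀ ∈ frontier Ω, ∀ ε : ℝ, 0 < ε → ε < ε₀ →
      ∀ x ∈ ball y₀ ε₁ ∩ closure Ω, |u ε x - F y₀| ≤ η := by
  have : NeZero N := ⟨by omega⟩
  have hNpos : (0 : ℝ) < N := by exact_mod_cast (by omega : 0 < N)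
  have hq0 : 0 < q := by rw [hq]; positivity
  have hq1 : q ≤ 1 := by
    rw [hq, div_le_one (by positivity)]
    linarith
  obtain ⟨ε₀, hε₀, ε₁, hε₁, h⟩ :=
    exists_boundary_upper_bound hq0 hq1 hΩb hΩc.nonempty hΩo hδbar hμ hΩlip K hη
  refine ⟨ε₀, hε₀, ε₁, hε₁, fun y₀ hy₀ ε hε hεlt x hx => ?_⟩
  have hv := hu ε hε
  have h1 := h F hF y₀ hy₀ ε hε hεlt (u ε) hv.isSubMVS hv.2.2.1 x hx
  have h2 := h (-F) hF.neg y₀ hy₀ ε hε hεlt (fun x => -u ε x) (hv.isSubMVS_neg hq1 hε)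
    (fun y hy => congrArg Neg.neg (hv.2.2.1 hy)) x hx
  rw [Pi.neg_apply] at h2
  rw [abs_le]
  constructor <;> linarith

end
end

section
/- Let u_ε denote, for each ε > 0, the ε-stochastic (equivalently ε-mean value) solution with boundary data F, and let ū and u̲ be the upper and lower half-relaxed limits of the family (u_ε) as ε → 0. Then ū is a viscosity subsolution and u̲ is a viscosity supersolution of the dominative p-Laplace equation D_p u = 0 in Ω. -/
open MeasureTheory Metric Set
open scoped ENNReal NNReal Classical

noncomputable section

variable {N : ℕ}

/-- upper half-relaxed limit of the family `(u_ε)` -/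
def ubarF (Ω : Set (EucN N)) (u : ℝ → EucN N → ℝ) (x : EucN N) : ℝ :=
  ⨅ δ : Ioi (0 : ℝ),
    sSup {r | ∃ ε y, 0 < ε ∧ ε < (δ : ℝ) ∧ y ∈ closure Ω ∧ dist y x ≤ (δ : ℝ) ∧ r = u ε y}

/-- lower half-relaxed limit of the family `(u_ε)` -/
def ulowF (Ω : Set (EucN N)) (u : ℝ → EucN N → ℝ) (x : EucN N) : ℝ :=
  ⨆ δ : Ioi (0 : ℝ),
    sInf {r | ∃ ε y, 0 < ε ∧ ε < (δ : ℝ) ∧ y ∈ closure Ω ∧ dist y x ≤ (δ : ℝ) ∧ r = u ε y}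

/-- The quadratic form of the Hessian of `v` at `x` evaluated at `ξ`. -/
def hessQF (v : EucN N → ℝ) (x ξ : EucN N) : ℝ := iteratedFDeriv ℝ 2 v x ![ξ, ξ]

/-- The dominative p-Laplacian `D_p v (x) = Δv(x) + (p-2) λ_max (D²v(x))`. -/
def domLap (p : ℝ) (v : EucN N → ℝ) (x : EucN N) : ℝ :=
  (∑ i : Fin N, hessQF v x (EuclideanSpace.single i 1)) +
    (p - 2) * ⨆ ξ : sphere (0 : EucN N) 1, hessQF v x (ξ : EucN N)

/-- viscosity subsolution of `D_p w = 0` on `Ω` -/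
def IsViscSubsol (p : ℝ) (Ω : Set (EucN N)) (w : EucN N → ℝ) : Prop :=
  ∀ x₀ ∈ Ω, ∀ φ : EucN N → ℝ, ContDiffOn ℝ 2 φ Ω → φ x₀ = w x₀ →
    (∀ x ∈ Ω, x ≠ x₀ → w x < φ x) → 0 ≤ domLap p φ x₀

/-- viscosity supersolution of `D_p w = 0` on `Ω` -/
def IsViscSupersol (p : ℝ) (Ω : Set (EucN N)) (w : EucN N → ℝ) : Prop :=
  ∀ x₀ ∈ Ω, ∀ φ : EucN N → ℝ, ContDiffOn ℝ 2 φ Ω → φ x₀ = w x₀ →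
    (∀ x ∈ Ω, x ≠ x₀ → φ x < w x) → domLap p φ x₀ ≤ 0

/-! ### Second moments of balls -/

lemma setIntegral_ball_comp_isometry (ε : ℝ) (f : EucN N ≃ₗᵢ[ℝ] EucN N) (g : EucN N → ℝ) :
    ∫ z in ball (0 : EucN N) ε, g (f z) = ∫ z in ball (0 : EucN N) ε, g z := by
  have h := f.measurePreserving.setIntegral_preimage_emb
    f.toHomeomorph.measurableEmbedding g (ball 0 ε)
  rwa [LinearIsometryEquiv.preimage_ball, map_zero] at h

lemma Continuous.integrableOn_ball {g : EucN N → ℝ} (hg : Continuous g) (x : EucN N) (ε : ℝ) :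
    IntegrableOn g (ball x ε) :=
  (hg.continuousOn.integrableOn_compact (isCompact_closedBall x ε)).mono_set ball_subset_closedBall

lemma setIntegral_ball_coord_mul_of_ne (ε : ℝ) {i j : Fin N} (hij : i ≠ j) :
    ∫ z in ball (0 : EucN N) ε, z i * z j = 0 := by
  let f : EucN N ≃ₗᵢ[ℝ] EucN N := LinearIsometryEquiv.piLpCongrRight 2
    (fun k => if k = i then LinearIsometryEquiv.neg ℝ else LinearIsometryEquiv.refl ℝ ℝ)
  have h := setIntegral_ball_comp_isometry ε f (fun z => z i * z j)
  have hf : ∀ z : EucN N, f z i * f z j = -(z i * z j) := by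
    intro z
    simp [f, hij.symm]
  simp only [hf, integral_neg] at h
  linarith

lemma setIntegral_ball_coord_sq_eq (ε : ℝ) (i j : Fin N) :
    ∫ z in ball (0 : EucN N) ε, z i * z i = ∫ z in ball (0 : EucN N) ε, z j * z j := by
  have h := setIntegral_ball_comp_isometry ε
    (LinearIsometryEquiv.piLpCongrLeft 2 ℝ ℝ (Equiv.swap i j)) (fun z => z j * z j)
  rw [← h]
  simp

lemma setIntegral_ball_norm_sq (hN : 2 ≤ N) {ε : ℝ} (hε : 0 < ε) :
    ∫ z in ball (0 : EucN N) ε, ‖z‖ ^ 2 =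
      volume.real (ball (0 : EucN N) ε) * ((N : ℝ) / (N + 2) * ε ^ 2) := by
  have : NeZero N := ⟨by omega⟩
  have hrew : ∫ z in ball (0 : EucN N) ε, ‖z‖ ^ 2 =
      ∫ z : EucN N, (fun r : ℝ => (Iio ε).indicator (fun r => r ^ 2) r) ‖z‖ := by
    rw [← integral_indicator measurableSet_ball]
    congr 1
    ext z
    simp [indicator]
  rw [hrew, integral_fun_norm_addHaar]
  have h1 : ∫ y in Ioi (0 : ℝ), y ^ (Module.finrank ℝ (EucN N) - 1) •
      (Iio ε).indicator (fun r : ℝ => r ^ 2) y = ε ^ (N + 2) / (N + 2) := by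
    rw [finrank_euclideanSpace_fin]
    have : ∀ y : ℝ, y ^ (N - 1) • (Iio ε).indicator (fun r : ℝ => r ^ 2) y =
        (Iio ε).indicator (fun r : ℝ => r ^ (N + 1)) y := by
      intro y
      by_cases hy : y ∈ Iio ε
      · simp only [indicator_of_mem hy, smul_eq_mul, ← pow_add]
        congr 1
        omega
      · simp [indicator_of_notMem hy]
    simp only [this]
    rw [setIntegral_indicator measurableSet_Iio, Ioi_inter_Iio, ← integral_Ioc_eq_integral_Ioo,
      ← intervalIntegral.integral_of_le hε.le, integral_pow]
    push_cast
    simp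
    ring
  rw [h1, Measure.real, Measure.real, Measure.addHaar_ball_of_pos _ _ hε,
    finrank_euclideanSpace_fin, ENNReal.toReal_mul, ENNReal.toReal_ofReal (by positivity)]
  simp only [smul_eq_mul, nsmul_eq_mul]
  have : (N : ℝ) + 2 ≠ 0 := by positivity
  field_simp
  ring

lemma setIntegral_ball_coord_sq (hN : 2 ≤ N) {ε : ℝ} (hε : 0 < ε) (i : Fin N) :
    ∫ z in ball (0 : EucN N) ε, z i * z i =
      volume.real (ball (0 : EucN N) ε) * (ε ^ 2 / (N + 2)) := by
  have h := setIntegral_ball_norm_sq hN hε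
  have hsq : ∀ z : EucN N, ‖z‖ ^ 2 = ∑ k, z k * z k := by
    intro z
    rw [EuclideanSpace.norm_sq_eq]
    simp [sq]
  simp only [hsq] at h
  rw [integral_finsetSum _ fun k _ => Continuous.integrableOn_ball (by fun_prop) 0 ε,
    Finset.sum_congr rfl fun k _ => setIntegral_ball_coord_sq_eq ε k i] at h
  simp only [Finset.sum_const, Finset.card_univ, Fintype.card_fin, nsmul_eq_mul] at h
  have hN0 : (N : ℝ) ≠ 0 := by
    have : N ≠ 0 := by omega
    exact_mod_cast this
  apply mul_left_cancel₀ hN0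
  rw [h]
  ring

/-- The inner product as a bilinear form. -/
def innerBilin : EucN N →L[ℝ] EucN N →L[ℝ] ℝ := innerSL ℝ

@[simp]
lemma innerBilin_self (x : EucN N) : innerBilin x x = ‖x‖ ^ 2 := real_inner_self_eq_norm_sq x

/-- The trace of a bilinear form on `ℝ^N`. -/
def bilinTrace (B : EucN N →L[ℝ] EucN N →L[ℝ] ℝ) : ℝ :=
  ∑ i : Fin N, B (EuclideanSpace.single i 1) (EuclideanSpace.single i 1)

lemma setIntegral_ball_bilin (hN : 2 ≤ N) {ε : ℝ} (hε : 0 < ε)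
    (B : EucN N →L[ℝ] EucN N →L[ℝ] ℝ) :
    ∫ z in ball (0 : EucN N) ε, B z z =
      volume.real (ball (0 : EucN N) ε) * (ε ^ 2 / (N + 2) * bilinTrace B) := by
  have hB : ∀ z : EucN N, B z z = ∑ i, ∑ j, z i * z j *
      B (EuclideanSpace.single i 1) (EuclideanSpace.single j 1) := by
    intro z
    have hz : z = ∑ i, z i • EuclideanSpace.single i (1 : ℝ) := by
      simpa using ((EuclideanSpace.basisFun (Fin N) ℝ).sum_repr z).symm
    conv_lhs => rw [hz]
    simp only [map_sum, map_smul, sum_apply, smul_apply,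
      smul_eq_mul, Finset.mul_sum]
    rw [Finset.sum_comm]
    exact Finset.sum_congr rfl fun i _ => Finset.sum_congr rfl fun j _ => by ring
  simp only [hB]
  rw [integral_finsetSum _ fun k _ => Continuous.integrableOn_ball (by fun_prop) 0 ε, bilinTrace,
    Finset.mul_sum, Finset.mul_sum]
  refine Finset.sum_congr rfl fun i _ => ?_
  rw [integral_finsetSum _ fun k _ => Continuous.integrableOn_ball (by fun_prop) 0 ε,
    Finset.sum_eq_single i]
  · rw [integral_mul_const, setIntegral_ball_coord_sq hN hε]
    ring
  · intro j _ hji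
    rw [integral_mul_const, setIntegral_ball_coord_mul_of_ne ε hji.symm, zero_mul]
  · simp

/-! ### Mean values of quadratic polynomials -/

/-- The quadratic polynomial with value `a`, gradient `L` and Hessian `B` at `x₀`. -/
def quadPoly (x₀ : EucN N) (a : ℝ) (L : EucN N →L[ℝ] ℝ) (B : EucN N →L[ℝ] EucN N →L[ℝ] ℝ)
    (x : EucN N) : ℝ :=
  a + L (x - x₀) + B (x - x₀) (x - x₀) / 2

@[fun_prop]
lemma continuous_quadPoly (x₀ : EucN N) (a : ℝ) (L : EucN N →L[ℝ] ℝ)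
    (B : EucN N →L[ℝ] EucN N →L[ℝ] ℝ) : Continuous (quadPoly x₀ a L B) := by
  unfold quadPoly
  fun_prop

lemma quadPoly_symm (x₀ : EucN N) (a : ℝ) (L : EucN N →L[ℝ] ℝ)
    (B : EucN N →L[ℝ] EucN N →L[ℝ] ℝ) (x z : EucN N) :
    quadPoly x₀ a L B (x + z) + quadPoly x₀ a L B (x - z) =
      2 * quadPoly x₀ a L B x + B z z := by
  have h1 : x + z - x₀ = (x - x₀) + z := by abel
  have h2 : x - z - x₀ = (x - x₀) - z := by abel
  simp only [quadPoly, h1, h2, map_add, map_sub, add_apply,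
    sub_apply]
  ring

lemma setAverage_quadPoly (hN : 2 ≤ N) {ε : ℝ} (hε : 0 < ε) (x₀ : EucN N) (a : ℝ)
    (L : EucN N →L[ℝ] ℝ) (B : EucN N →L[ℝ] EucN N →L[ℝ] ℝ) (x : EucN N) :
    ⨍ y in ball x ε, quadPoly x₀ a L B y =
      quadPoly x₀ a L B x + ε ^ 2 / 2 * (bilinTrace B / (N + 2)) := by
  set P := quadPoly x₀ a L B with hP
  have hPc : Continuous P := continuous_quadPoly x₀ a L B
  have htr : ∫ y in ball x ε, P y = ∫ z in ball (0 : EucN N) ε, P (x + z) := by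
    have h := (measurePreserving_add_left (volume : Measure (EucN N)) x).setIntegral_preimage_emb
      (Homeomorph.addLeft x).measurableEmbedding P (ball x ε)
    rw [← h]
    congr 2
    ext z
    simp
  have hneg : ∫ z in ball (0 : EucN N) ε, P (x + z) = ∫ z in ball (0 : EucN N) ε, P (x - z) := by
    rw [← setIntegral_ball_comp_isometry ε (LinearIsometryEquiv.neg ℝ)]
    simp [sub_eq_add_neg]
  have hsum : (∫ z in ball (0 : EucN N) ε, P (x + z)) + (∫ z in ball (0 : EucN N) ε, P (x - z)) =
      volume.real (ball (0 : EucN N) ε) * (2 * P x + ε ^ 2 / (N + 2) * bilinTrace B) := by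
    rw [← integral_add (Continuous.integrableOn_ball (by fun_prop) 0 ε)
      (Continuous.integrableOn_ball (by fun_prop) 0 ε)]
    simp only [hP, quadPoly_symm]
    rw [integral_add (Continuous.integrableOn_ball (by fun_prop) 0 ε)
      (Continuous.integrableOn_ball (by fun_prop) 0 ε), setIntegral_ball_bilin hN hε]
    simp
    ring
  have hvol : volume.real (ball x ε) = volume.real (ball (0 : EucN N) ε) := by
    simp [Measure.real, Measure.addHaar_ball_center]
  have hpos : 0 < volume.real (ball (0 : EucN N) ε) :=
    ENNReal.toReal_pos (measure_ball_pos volume 0 hε).ne' measure_ball_lt_top.ne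
  rw [setAverage_eq, htr, hvol, smul_eq_mul, inv_mul_eq_div, div_eq_iff hpos.ne']
  linear_combination (1 / 2) * hsum + (1 / 2) * hneg

lemma mveOp_quadPoly (hN : 2 ≤ N) {p q : ℝ} (hp : 2 ≤ p)
    (hq : q = ((N : ℝ) + 2) / ((N : ℝ) + p)) {ε : ℝ} (hε : 0 < ε) (x₀ : EucN N) (a : ℝ)
    (L : EucN N →L[ℝ] ℝ) (B : EucN N →L[ℝ] EucN N →L[ℝ] ℝ) (ξ x : EucN N) :
    mveOp q ε (quadPoly x₀ a L B) ξ x = quadPoly x₀ a L B x +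
      ε ^ 2 / (2 * (N + p)) * (bilinTrace B + (p - 2) * B ξ ξ) := by
  rw [mveOp, setAverage_quadPoly hN hε, quadPoly_symm, hq]
  simp only [map_smul, smul_apply, smul_eq_mul]
  have h1 : (N : ℝ) + 2 ≠ 0 := by positivity
  have h2 : (N : ℝ) + p ≠ 0 := by positivity
  field_simp
  ring

/-! ### Comparison for the mean value operators -/

lemma mveOp_sub {q ε : ℝ} {v w : EucN N → ℝ} {x : EucN N} (hv : IntegrableOn v (ball x ε))
    (hw : IntegrableOn w (ball x ε)) (ξ : EucN N) :
    mveOp q ε (fun y => v y - w y) ξ x = mveOp q ε v ξ x - mveOp q ε w ξ x := by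
  simp only [mveOp, setAverage_eq, smul_eq_mul]
  rw [integral_sub hv hw]
  ring

lemma mveOp_le_of_le {q ε : ℝ} (hε : 0 < ε) (hq0 : 0 ≤ q) (hq1 : q ≤ 1) {v : EucN N → ℝ}
    {ξ x : EucN N} (hξ : ‖ξ‖ = 1) {C : ℝ} (hvi : IntegrableOn v (ball x ε))
    (hv : ∀ y ∈ closedBall x ε, v y ≤ C) : mveOp q ε v ξ x ≤ C := by
  have havg : ⨍ y in ball x ε, v y ≤ C := by
    have hpos : 0 < volume.real (ball x ε) :=
      ENNReal.toReal_pos (measure_ball_pos volume x hε).ne' measure_ball_lt_top.ne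
    have h : ∫ y in ball x ε, v y ≤ ∫ _ in ball x ε, C :=
      setIntegral_mono_on hvi (integrableOn_const measure_ball_lt_top.ne) measurableSet_ball
        fun y hy => hv y (ball_subset_closedBall hy)
    rw [setIntegral_const, smul_eq_mul] at h
    rw [setAverage_eq, smul_eq_mul, inv_mul_eq_div, div_le_iff₀ hpos]
    linarith
  have h1 : v (x + ε • ξ) ≤ C := hv _ (by simp [norm_smul, hξ, abs_of_pos hε])
  have h2 : v (x - ε • ξ) ≤ C := hv _ (by
    simp [norm_smul, hξ, abs_of_pos hε, mem_closedBall])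
  unfold mveOp
  nlinarith

/-- A function strictly below one of its directional mean values on `G` is bounded on `G'` by its
bound on `G' \ G`. -/
lemma le_of_le_mveOp_sub {q ε : ℝ} (hε : 0 < ε) (hq0 : 0 ≤ q) (hq1 : q ≤ 1) {G G' : Set (EucN N)}
    {w : EucN N → ℝ} (hG : ∀ x ∈ G, closedBall x ε ⊆ G') {C : ℝ} (hC : ∀ x ∈ G', w x ≤ C)
    (hwi : ∀ x ∈ G, IntegrableOn w (ball x ε)) {κ : ℝ} (hκ : 0 < κ)
    (hstep : ∀ x ∈ G, ∃ ξ : EucN N, ‖ξ‖ = 1 ∧ w x ≤ mveOp q ε w ξ x - κ) {m : ℝ}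
    (hm : ∀ x ∈ G', x ∉ G → w x ≤ m) : ∀ x ∈ G', w x ≤ m := by
  by_contra! h
  obtain ⟨x, hx, hmx⟩ := h
  have hbdd : BddAbove (w '' G') := ⟨C, by rintro _ ⟨y, hy, rfl⟩; exact hC y hy⟩
  have hxS : w x ≤ sSup (w '' G') := le_csSup hbdd ⟨x, hx, rfl⟩
  obtain ⟨_, ⟨y, hy, rfl⟩, hyS⟩ := exists_lt_of_lt_csSup (⟨w x, x, hx, rfl⟩ : (w '' G').Nonempty)
    (max_lt (hmx.trans_le hxS) (sub_lt_self (sSup (w '' G')) hκ))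
  rw [max_lt_iff] at hyS
  have hyG : y ∈ G := by
    by_contra hyG
    exact absurd (hm y hy hyG) (not_le.mpr hyS.1)
  obtain ⟨ξ, hξ, hstep⟩ := hstep y hyG
  have := mveOp_le_of_le hε hq0 hq1 hξ (hwi y hyG)
    fun z hz => le_csSup hbdd ⟨z, hG y hyG hz, rfl⟩
  linarith [hyS.2]

lemma IsMVS.integrableOn_ball {q ε : ℝ} {Ω : Set (EucN N)} {F v : EucN N → ℝ}
    (h : IsMVS q ε Ω F v) {x : EucN N} (hx : x ∈ closure Ω) : IntegrableOn v (ball x ε) := by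
  obtain ⟨hmeas, ⟨C, hC⟩, -⟩ := h
  refine Measure.integrableOn_of_bounded (M := C) measure_ball_lt_top.ne
    hmeas.aestronglyMeasurable ?_
  filter_upwards [ae_restrict_mem measurableSet_ball] with y hy
  exact hC y (closedBall_subset_Oeps hx (ball_subset_closedBall hy))

lemma IsMVS.mveOp_le {q ε : ℝ} (hε : 0 < ε) (hq0 : 0 ≤ q) (hq1 : q ≤ 1) {Ω : Set (EucN N)}
    {F v : EucN N → ℝ} (h : IsMVS q ε Ω F v) {x : EucN N} (hx : x ∈ closure Ω) {ξ : EucN N}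
    (hξ : ‖ξ‖ = 1) : mveOp q ε v ξ x ≤ v x := by
  have hvi := h.integrableOn_ball hx
  obtain ⟨-, ⟨C, hC⟩, -, -, heq⟩ := h
  rw [heq x hx]
  refine le_ciSup (f := fun ξ : sphere (0 : EucN N) 1 => mveOp q ε v (ξ : EucN N) x)
    ⟨C, ?_⟩ ⟨ξ, by simpa using hξ⟩
  rintro _ ⟨η, rfl⟩
  exact mveOp_le_of_le hε hq0 hq1 (by simp) hvi
    fun y hy => (abs_le.mp (hC y (closedBall_subset_Oeps hx hy))).2

lemma exists_norm_eq_one (hN : 2 ≤ N) : ∃ ξ : EucN N, ‖ξ‖ = 1 :=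
  ⟨EuclideanSpace.single ⟨0, by omega⟩ 1, by simp⟩

lemma nonempty_unitSphere (hN : 2 ≤ N) : Nonempty (sphere (0 : EucN N) 1) := by
  obtain ⟨ξ, hξ⟩ := exists_norm_eq_one hN
  exact ⟨ξ, by simpa using hξ⟩

lemma IsMVS.exists_lt_mveOp_add (hN : 2 ≤ N) {q ε : ℝ} {Ω : Set (EucN N)}
    {F v : EucN N → ℝ} (h : IsMVS q ε Ω F v) {x : EucN N} (hx : x ∈ closure Ω) {τ : ℝ}
    (hτ : 0 < τ) : ∃ ξ : EucN N, ‖ξ‖ = 1 ∧ v x < mveOp q ε v ξ x + τ := by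
  have := nonempty_unitSphere hN
  have hx' := h.2.2.2.2 x hx
  obtain ⟨ξ, hξ⟩ := exists_lt_of_lt_ciSup
    (show v x - τ < ⨆ ξ : sphere (0 : EucN N) 1, mveOp q ε v (ξ : EucN N) x by
      change _ < mvOp q ε v x
      linarith)
  exact ⟨ξ, by simp, by linarith⟩

/-- A mean value solution minus a strict supersolution lies strictly below one of its directional
mean values. -/
lemma IsMVS.sub_le_mveOp_sub (hN : 2 ≤ N) {q ε : ℝ} {Ω : Set (EucN N)} {F v P : EucN N → ℝ}
    (h : IsMVS q ε Ω F v) (hP : Continuous P) {x : EucN N} (hx : x ∈ closure Ω) {κ : ℝ}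
    (hκ : 0 < κ) (hPκ : ∀ ξ : EucN N, ‖ξ‖ = 1 → mveOp q ε P ξ x ≤ P x - 2 * κ) :
    ∃ ξ : EucN N, ‖ξ‖ = 1 ∧ v x - P x ≤ mveOp q ε (fun y => v y - P y) ξ x - κ := by
  obtain ⟨ξ, hξ, hlt⟩ := h.exists_lt_mveOp_add hN hx hκ
  refine ⟨ξ, hξ, ?_⟩
  rw [mveOp_sub (h.integrableOn_ball hx) (hP.integrableOn_ball x ε)]
  linarith [hPκ ξ hξ]

lemma IsMVS.neg_sub_le_mveOp_neg_sub {q ε : ℝ} (hε : 0 < ε) (hq0 : 0 ≤ q)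
    (hq1 : q ≤ 1) {Ω : Set (EucN N)} {F v P : EucN N → ℝ}
    (h : IsMVS q ε Ω F v) (hP : Continuous P) {x : EucN N} (hx : x ∈ closure Ω) {κ : ℝ}
    {ξ : EucN N} (hξ : ‖ξ‖ = 1) (hPκ : mveOp q ε P ξ x ≤ P x - κ) :
    -v x - P x ≤ mveOp q ε (fun y => -v y - P y) ξ x - κ := by
  rw [mveOp_sub (v := fun y => -v y) (h.integrableOn_ball hx).neg (hP.integrableOn_ball x ε),
    mveOp_neg]
  linarith [h.mveOp_le hε hq0 hq1 hx hξ]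

lemma abs_le_on_Geps {Ω : Set (EucN N)} (hΩb : Bornology.IsBounded Ω) (hΩn : Ω.Nonempty)
    {F : EucN N → ℝ} {K : ℝ≥0} (hF : LipschitzOnWith K F Ωᶜ) (δ : ℝ) :
    ∃ R C : ℝ, ∀ ε < δ, ∀ y ∈ Oeps Ω ε, ‖y‖ ≤ R ∧ (y ∉ closure Ω → |F y| ≤ C) := by
  obtain ⟨R, hR⟩ := hΩb.exists_norm_le
  have hRδ : ∀ ε < δ, ∀ y ∈ Oeps Ω ε, ‖y‖ ≤ R + δ := by
    intro ε hε y hy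
    obtain ⟨z, hz, hyz⟩ := (infDist_lt_iff hΩn).mp (lt_of_le_of_lt hy hε)
    have := norm_le_norm_add_norm_sub' y z
    rw [dist_eq_norm] at hyz
    linarith [hR z hz]
  have hbdd : Bornology.IsBounded (F '' (Ωᶜ ∩ closedBall 0 (R + δ))) := by
    obtain ⟨g, hg, hgF⟩ := hF.extend_real
    have h2 : F '' (Ωᶜ ∩ closedBall 0 (R + δ)) = g '' (Ωᶜ ∩ closedBall 0 (R + δ)) :=
      image_congr fun y hy => hgF hy.1
    rw [h2]
    exact hg.isBounded_image (isBounded_closedBall.subset inter_subset_right)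
  obtain ⟨C, hC⟩ := hbdd.exists_norm_le
  refine ⟨R + δ, C, fun ε hε y hy => ⟨hRδ ε hε y hy, fun hyn => ?_⟩⟩
  exact hC (F y) ⟨y, ⟨fun h => hyn (subset_closure h), by simpa using hRδ ε hε y hy⟩, rfl⟩

lemma IsMVS.abs_le_add_sq (hN : 2 ≤ N) {p q : ℝ} (hp : 2 ≤ p)
    (hq : q = ((N : ℝ) + 2) / ((N : ℝ) + p)) (hq0 : 0 ≤ q) (hq1 : q ≤ 1) {Ω : Set (EucN N)}
    {F v : EucN N → ℝ} {ε : ℝ} (hε : 0 < ε) (h : IsMVS q ε Ω F v) {R C : ℝ}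
    (hRC : ∀ y ∈ Oeps Ω ε, ‖y‖ ≤ R ∧ (y ∉ closure Ω → |F y| ≤ C)) :
    ∀ x ∈ closure Ω, |v x| ≤ C + R ^ 2 := by
  set B : EucN N →L[ℝ] EucN N →L[ℝ] ℝ := (-2 : ℝ) • innerBilin with hB
  set P := quadPoly 0 0 0 B with hPdef
  have hPc : Continuous P := continuous_quadPoly _ _ _ _
  have hPx : ∀ x, P x = -‖x‖ ^ 2 := by
    intro x
    simp [hPdef, quadPoly, hB]
    ring
  set κ := ε ^ 2 / (2 * (N + p)) with hκdef
  have hκ : 0 < κ := by positivity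
  have hPκ : ∀ x ξ : EucN N, ‖ξ‖ = 1 → mveOp q ε P ξ x ≤ P x - 2 * κ := by
    intro x ξ hξ
    rw [hPdef, mveOp_quadPoly hN hp hq hε, ← hPdef]
    have htr : bilinTrace B = -2 * N := by
      simp [bilinTrace, hB]
      ring
    have hBξ : B ξ ξ = -2 := by simp [hB, hξ]
    have hN' : (2 : ℝ) ≤ N := by exact_mod_cast hN
    rw [htr, hBξ, ← hκdef]
    nlinarith
  obtain ⟨D, hD⟩ := h.2.1
  have hsub : ∀ x ∈ closure Ω, x ∈ Oeps Ω ε := fun x hx =>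
    closedBall_subset_Oeps hx (mem_closedBall_self hε.le)
  have hP_le : ∀ x ∈ Oeps Ω ε, -P x ≤ R ^ 2 := by
    intro x hx
    rw [hPx]
    nlinarith [norm_nonneg x, (hRC x hx).1]
  have hP0 : ∀ x, P x ≤ 0 := fun x => by rw [hPx]; nlinarith [norm_nonneg x]
  have hFv : ∀ x ∈ Oeps Ω ε, x ∉ closure Ω → |v x| ≤ C := fun x hx hxn => by
    rw [h.2.2.1 ⟨hx, hxn⟩]
    exact (hRC x hx).2 hxn
  have hup : ∀ x ∈ Oeps Ω ε, v x - P x ≤ C + R ^ 2 := by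
    refine le_of_le_mveOp_sub (G := closure Ω) (w := fun y => v y - P y) (C := D + R ^ 2) hε hq0 hq1
      (fun x hx => closedBall_subset_Oeps hx) (fun x hx => ?_)
      (fun x hx => (h.integrableOn_ball hx).sub (hPc.integrableOn_ball x ε)) hκ
      (fun x hx => h.sub_le_mveOp_sub hN hPc hx hκ (hPκ x)) fun x hx hxn => ?_
    · linarith [(abs_le.mp (hD x hx)).2, hP_le x hx]
    · linarith [(abs_le.mp (hFv x hx hxn)).2, hP_le x hx]
  obtain ⟨ξ, hξ⟩ := exists_norm_eq_one hN
  have hlow : ∀ x ∈ Oeps Ω ε, -v x - P x ≤ C + R ^ 2 := by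
    refine le_of_le_mveOp_sub (G := closure Ω) (w := fun y => -v y - P y) (C := D + R ^ 2) hε hq0
      hq1 (fun x hx => closedBall_subset_Oeps hx) (fun x hx => ?_)
      (fun x hx => (h.integrableOn_ball hx).neg.sub (hPc.integrableOn_ball x ε)) hκ
      (fun x hx => ⟨ξ, hξ, h.neg_sub_le_mveOp_neg_sub hε hq0 hq1 hPc hx hξ
        (by linarith [hPκ x ξ hξ])⟩) fun x hx hxn => ?_
    · linarith [(abs_le.mp (hD x hx)).1, hP_le x hx]
    · linarith [(abs_le.mp (hFv x hx hxn)).1, hP_le x hx]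
  intro x hx
  rw [abs_le]
  constructor <;> linarith [hup x (hsub x hx), hlow x (hsub x hx), hP0 x]

/-! ### Half-relaxed limits -/

lemma ulowF_eq_neg_ubarF (Ω : Set (EucN N)) (u : ℝ → EucN N → ℝ) (x : EucN N) :
    ulowF Ω u x = -ubarF Ω (fun ε y => -u ε y) x := by
  have h : ∀ δ : ℝ, sInf {r | ∃ ε y, 0 < ε ∧ ε < δ ∧ y ∈ closure Ω ∧ dist y x ≤ δ ∧ r = u ε y} =
      -sSup {r | ∃ ε y, 0 < ε ∧ ε < δ ∧ y ∈ closure Ω ∧ dist y x ≤ δ ∧ r = -u ε y} := by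
    intro δ
    rw [Real.sInf_def]
    congr 2
    ext r
    simp [neg_eq_iff_eq_neg]
  simp only [ulowF, ubarF, h, iSup, iInf]
  rw [Real.sInf_def, neg_neg]
  congr 1
  ext r
  simp [neg_eq_iff_eq_neg, eq_comm]

/-- Boundedness of a family on `closure Ω`, locally uniformly in the parameter. -/
def LocUnifBdd (Ω : Set (EucN N)) (v : ℝ → EucN N → ℝ) : Prop :=
  ∀ δ, 0 < δ → ∃ C, ∀ ε, 0 < ε → ε < δ → ∀ y ∈ closure Ω, |v ε y| ≤ C

lemma LocUnifBdd.bddAbove {Ω : Set (EucN N)} {v : ℝ → EucN N → ℝ} (hv : LocUnifBdd Ω v)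
    (x : EucN N) {δ : ℝ} (hδ : 0 < δ) :
    BddAbove {r | ∃ ε y, 0 < ε ∧ ε < δ ∧ y ∈ closure Ω ∧ dist y x ≤ δ ∧ r = v ε y} := by
  obtain ⟨C, hC⟩ := hv δ hδ
  refine ⟨C, ?_⟩
  rintro _ ⟨ε, y, hε, hεδ, hy, -, rfl⟩
  exact (abs_le.mp (hC ε hε hεδ y hy)).2

lemma LocUnifBdd.exists_lt_of_ubarF_lt {Ω : Set (EucN N)} {v : ℝ → EucN N → ℝ}
    (hv : LocUnifBdd Ω v) {x : EucN N} {c : ℝ} (h : ubarF Ω v x < c) :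
    ∃ δ, 0 < δ ∧ ∀ ε, 0 < ε → ε < δ → ∀ y ∈ closure Ω, dist y x ≤ δ → v ε y < c := by
  have : Nonempty (Ioi (0 : ℝ)) := ⟨⟨1, mem_Ioi.mpr one_pos⟩⟩
  obtain ⟨⟨δ, hδ⟩, hlt⟩ := exists_lt_of_ciInf_lt h
  exact ⟨δ, hδ, fun ε hε hεδ y hy hyx =>
    (le_csSup (hv.bddAbove x hδ) ⟨ε, y, hε, hεδ, hy, hyx, rfl⟩).trans_lt hlt⟩

lemma LocUnifBdd.ubarF_le {Ω : Set (EucN N)} {v : ℝ → EucN N → ℝ} (hv : LocUnifBdd Ω v)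
    {x : EucN N} (hx : x ∈ closure Ω) {c δ : ℝ} (hδ : 0 < δ)
    (h : ∀ ε, 0 < ε → ε < δ → ∀ y ∈ closure Ω, dist y x ≤ δ → v ε y ≤ c) :
    ubarF Ω v x ≤ c := by
  obtain ⟨C, hC⟩ := hv 1 one_pos
  refine ciInf_le_of_le ⟨-C, ?_⟩ (⟨δ, hδ⟩ : Ioi (0 : ℝ)) ?_
  · rintro _ ⟨⟨δ', hδ'⟩, rfl⟩
    have hδ'0 : 0 < δ' := hδ'
    have hmin : 0 < min δ' 1 := lt_min hδ' one_pos
    refine le_trans ?_ (le_csSup (hv.bddAbove x hδ')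
      ⟨min δ' 1 / 2, x, by linarith, by linarith [min_le_left δ' 1], hx, by simpa using hδ'0.le, rfl⟩)
    exact (abs_le.mp (hC _ (by linarith) (by linarith [min_le_right δ' 1]) x hx)).1
  · refine csSup_le ⟨_, δ / 2, x, by linarith, by simp; linarith, hx, by simpa using hδ.le, rfl⟩ ?_
    rintro _ ⟨ε, y, hε, hεδ, hy, hyx, rfl⟩
    exact h ε hε hεδ y hy hyx

lemma LocUnifBdd.exists_le_sub_of_isCompact {Ω : Set (EucN N)} {v : ℝ → EucN N → ℝ}
    (hv : LocUnifBdd Ω v) {P : EucN N → ℝ} (hP : Continuous P) {A : Set (EucN N)}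
    (hA : IsCompact A) (hAΩ : A ⊆ closure Ω) (hlt : ∀ x ∈ A, ubarF Ω v x < P x) :
    ∃ δ θ, 0 < δ ∧ 0 < θ ∧ ∀ ε, 0 < ε → ε < δ → ∀ y ∈ A, v ε y ≤ P y - θ := by
  suffices H : ∃ δ θ, 0 < δ ∧ 0 < θ ∧ ∀ ε, 0 < ε → ε < δ → ∀ y ∈ A, y ∈ A → v ε y ≤ P y - θ by
    obtain ⟨δ, θ, hδ, hθ, h⟩ := H
    exact ⟨δ, θ, hδ, hθ, fun ε h1 h2 y hy => h ε h1 h2 y hy hy⟩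
  refine hA.induction_on (p := fun s => ∃ δ θ, 0 < δ ∧ 0 < θ ∧
    ∀ ε, 0 < ε → ε < δ → ∀ y ∈ s, y ∈ A → v ε y ≤ P y - θ) ?_ ?_ ?_ ?_
  · exact ⟨1, 1, one_pos, one_pos, by simp⟩
  · rintro s t hst ⟨δ, θ, hδ, hθ, h⟩
    exact ⟨δ, θ, hδ, hθ, fun ε h1 h2 y hy => h ε h1 h2 y (hst hy)⟩
  · rintro s t ⟨δ, θ, hδ, hθ, h⟩ ⟨δ', θ', hδ', hθ', h'⟩
    refine ⟨min δ δ', min θ θ', lt_min hδ hδ', lt_min hθ hθ', fun ε h1 h2 y hy hyA => ?_⟩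
    rw [lt_min_iff] at h2
    rcases hy with hy | hy
    · linarith [h ε h1 h2.1 y hy hyA, min_le_left θ θ']
    · linarith [h' ε h1 h2.2 y hy hyA, min_le_right θ θ']
  · intro x hx
    have hlt' := hlt x hx
    obtain ⟨c, hc1, hc2⟩ := exists_between hlt'
    obtain ⟨d, hd1, hd2⟩ := exists_between hc2
    obtain ⟨δ, hδ, h⟩ := hv.exists_lt_of_ubarF_lt hc1
    refine ⟨closedBall x δ ∩ {y | d < P y}, mem_nhdsWithin_of_mem_nhds (Filter.inter_mem
      (closedBall_mem_nhds x hδ) (hP.continuousAt.eventually (lt_mem_nhds hd2))),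
      δ, d - c, hδ, by linarith, fun ε h1 h2 y hy hyA => ?_⟩
    have h3 := h ε h1 h2 y (hAΩ hyA) hy.1
    have h4 : d < P y := hy.2
    linarith

/-- A function which touches the upper half-relaxed limit strictly from above cannot be such that
the differences `v ε - P` lie strictly below one of their directional mean values. -/
lemma LocUnifBdd.not_touching {Ω : Set (EucN N)} {v : ℝ → EucN N → ℝ}
    (hv : LocUnifBdd Ω v) {q : ℝ} (hq0 : 0 ≤ q) (hq1 : q ≤ 1) {P : EucN N → ℝ}
    (hP : Continuous P) (hvi : ∀ ε, 0 < ε → ∀ x ∈ closure Ω, IntegrableOn (v ε) (ball x ε))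
    {x₀ : EucN N} {r : ℝ} (hr : 0 < r) (hrΩ : closedBall x₀ r ⊆ Ω)
    (hx₀ : ubarF Ω v x₀ = P x₀) (hlt : ∀ x ∈ closedBall x₀ r, x ≠ x₀ → ubarF Ω v x < P x)
    (hstep : ∀ ε, 0 < ε → ∃ κ, 0 < κ ∧ ∀ x ∈ Ω, ∃ ξ : EucN N, ‖ξ‖ = 1 ∧
      v ε x - P x ≤ mveOp q ε (fun y => v ε y - P y) ξ x - κ) : False := by
  have hcl : closedBall x₀ r ⊆ closure Ω := hrΩ.trans subset_closure
  obtain ⟨δ, θ, hδ, hθ, h⟩ := hv.exists_le_sub_of_isCompact hP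
    (A := closedBall x₀ r \ ball x₀ (r / 2)) ((isCompact_closedBall x₀ r).diff isOpen_ball)
    (sdiff_subset.trans hcl) fun x hx => hlt x hx.1 fun hxx => hx.2 (by simp [hxx, hr])
  have hall : ∀ ε, 0 < ε → ε < min δ (r / 2) → ∀ y ∈ closedBall x₀ r, v ε y - P y ≤ -θ := by
    intro ε hε hεδ
    rw [lt_min_iff] at hεδ
    obtain ⟨κ, hκ, hstep⟩ := hstep ε hε
    obtain ⟨C, hC⟩ := hv δ hδ
    obtain ⟨D, hD⟩ := (isCompact_closedBall x₀ r).exists_bound_of_continuousOn hP.continuousOn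
    have hsub : ball x₀ (r / 2) ⊆ closedBall x₀ r :=
      (ball_subset_ball (by linarith)).trans ball_subset_closedBall
    refine le_of_le_mveOp_sub (G := ball x₀ (r / 2)) (w := fun y => v ε y - P y) (C := C + D) hε hq0
      hq1 (fun x hx => ?_)
      (fun x hx => ?_) (fun x hx => (hvi ε hε x (hcl (hsub hx))).sub (hP.integrableOn_ball x ε)) hκ
      (fun x hx => hstep x (hrΩ (hsub hx))) fun x hx hxn => ?_
    · exact closedBall_subset_closedBall' (by linarith [mem_ball.mp hx])
    · have h1 := hD x hx
      rw [Real.norm_eq_abs] at h1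
      linarith [(abs_le.mp (hC ε hε hεδ.1 x (hcl hx))).2, (abs_le.mp h1).1]
    · linarith [h ε hε hεδ.1 x ⟨hx, hxn⟩]
  obtain ⟨ρ, hρ, hPρ⟩ := Metric.continuousAt_iff.mp hP.continuousAt (θ / 2) (by linarith)
  have hmin : 0 < min (min δ (r / 2)) (ρ / 2) := by positivity
  have hle : ubarF Ω v x₀ ≤ P x₀ - θ / 2 := by
    refine hv.ubarF_le (hcl (mem_closedBall_self hr.le)) hmin fun ε hε hεδ y _ hyx => ?_
    have h1 := hyx.trans (min_le_right _ _)
    have h2 := (hyx.trans (min_le_left _ _)).trans (min_le_right _ _)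
    have h3 := hall ε hε (hεδ.trans_le (min_le_left _ _)) y (mem_closedBall.mpr (by linarith))
    have h4 := hPρ (show dist y x₀ < ρ by linarith)
    rw [Real.dist_eq] at h4
    linarith [(abs_lt.mp h4).2]
  linarith

/-! ### Second order Taylor expansion -/

lemma exists_abs_sub_quadPoly_le {Ω : Set (EucN N)} (hΩ : IsOpen Ω) {φ : EucN N → ℝ}
    (hφ : ContDiffOn ℝ 2 φ Ω) {x₀ : EucN N} (hx₀ : x₀ ∈ Ω) {η : ℝ} (hη : 0 < η) :
    ∃ r, 0 < r ∧ closedBall x₀ r ⊆ Ω ∧ ∀ x ∈ closedBall x₀ r,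
      |φ x - quadPoly x₀ (φ x₀) (fderiv ℝ φ x₀) (fderiv ℝ (fderiv ℝ φ) x₀) x| ≤
        η * ‖x - x₀‖ ^ 2 := by
  set L := fderiv ℝ φ x₀
  set B := fderiv ℝ (fderiv ℝ φ) x₀
  have hφ₀ : ContDiffAt ℝ 2 φ x₀ := hφ.contDiffAt (hΩ.mem_nhds hx₀)
  have hsymm : ∀ x y, B x y = B y x :=
    fun x y => (hφ₀.isSymmSndFDerivAt (by simp)).eq x y
  have hB : HasFDerivAt (fderiv ℝ φ) B x₀ :=
    ((hφ₀.fderiv_right (m := 1) (by norm_num)).differentiableAt (by norm_num)).hasFDerivAt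
  have hlit := hB.isLittleO.def hη
  obtain ⟨r₀, hr₀, hball⟩ := Metric.eventually_nhds_iff_ball.mp (hlit.and (hΩ.mem_nhds hx₀))
  have hr : ∀ x ∈ closedBall x₀ (r₀ / 2), x ∈ ball x₀ r₀ := fun x hx =>
    mem_ball.mpr (by linarith [mem_closedBall.mp hx])
  refine ⟨r₀ / 2, by linarith, fun x hx => (hball x (hr x hx)).2, fun x hx => ?_⟩
  have hder : ∀ y ∈ closedBall x₀ ‖x - x₀‖, HasFDerivWithinAt
      (fun y => φ y - quadPoly x₀ (φ x₀) L B y) (fderiv ℝ φ y - L - B (y - x₀))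
      (closedBall x₀ ‖x - x₀‖) y := by
    intro y hy
    have hyx : y ∈ closedBall x₀ (r₀ / 2) := by
      rw [mem_closedBall, dist_eq_norm] at *
      linarith
    have hφy : HasFDerivAt φ (fderiv ℝ φ y) y :=
      ((hφ.contDiffAt (hΩ.mem_nhds (hball y (hr y hyx)).2)).differentiableAt
        (by norm_num)).hasFDerivAt
    have hid : HasFDerivAt (fun y : EucN N => y - x₀) (ContinuousLinearMap.id ℝ (EucN N)) y :=
      (hasFDerivAt_id y).sub_const x₀
    have hq : HasFDerivAt (quadPoly x₀ (φ x₀) L B) (L + B (y - x₀)) y := by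
      have h1 := ((L.hasFDerivAt.comp y hid).const_add (φ x₀)).add
        (((B.hasFDerivAt.comp y hid).clm_apply hid).mul_const (1 / 2 : ℝ))
      refine (h1.congr_fderiv ?_).congr_of_eventuallyEq (Filter.Eventually.of_forall fun z => ?_)
      · ext z
        simp only [add_apply, smul_apply, ContinuousLinearMap.comp_apply,
          ContinuousLinearMap.flip_apply, ContinuousLinearMap.id_apply, Function.comp_apply,
          hsymm z (y - x₀), smul_eq_mul]
        ring
      · simp [quadPoly]
        ring
    exact ((hφy.sub hq).congr_fderiv (by abel)).hasFDerivWithinAt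
  have hbound : ∀ y ∈ closedBall x₀ ‖x - x₀‖, ‖fderiv ℝ φ y - L - B (y - x₀)‖ ≤ η * ‖x - x₀‖ := by
    intro y hy
    rw [mem_closedBall, dist_eq_norm] at hy hx
    have hyx : y ∈ ball x₀ r₀ := by
      rw [mem_ball, dist_eq_norm]
      linarith
    exact (hball y hyx).1.trans (by gcongr)
  have h := Convex.norm_image_sub_le_of_norm_hasFDerivWithin_le hder hbound (convex_closedBall _ _)
    (mem_closedBall_self (norm_nonneg _)) (show x ∈ closedBall x₀ ‖x - x₀‖ by
      simp [mem_closedBall, dist_eq_norm])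
  have h0 : φ x₀ - quadPoly x₀ (φ x₀) L B x₀ = 0 := by simp [quadPoly]
  rw [h0, sub_zero, Real.norm_eq_abs] at h
  linarith

lemma quadPoly_add_smul_innerBilin (x₀ : EucN N) (a η : ℝ) (L : EucN N →L[ℝ] ℝ)
    (B : EucN N →L[ℝ] EucN N →L[ℝ] ℝ) (x : EucN N) :
    quadPoly x₀ a L (B + η • innerBilin) x = quadPoly x₀ a L B x + η / 2 * ‖x - x₀‖ ^ 2 := by
  simp only [quadPoly, add_apply, smul_apply, smul_eq_mul, innerBilin_self]
  ring

lemma quadPoly_neg (x₀ : EucN N) (a : ℝ) (L : EucN N →L[ℝ] ℝ)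
    (B : EucN N →L[ℝ] EucN N →L[ℝ] ℝ) (x : EucN N) :
    quadPoly x₀ (-a) (-L) (-B) x = -quadPoly x₀ a L B x := by
  simp [quadPoly]
  ring

lemma bilinTrace_add_smul_innerBilin (B : EucN N →L[ℝ] EucN N →L[ℝ] ℝ) (η : ℝ) :
    bilinTrace (B + η • innerBilin) = bilinTrace B + N * η := by
  simp [bilinTrace, Finset.sum_add_distrib]

lemma bilinTrace_neg (B : EucN N →L[ℝ] EucN N →L[ℝ] ℝ) : bilinTrace (-B) = -bilinTrace B := by
  simp [bilinTrace]

lemma domLap_eq (p : ℝ) (φ : EucN N → ℝ) (x₀ : EucN N) :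
    domLap p φ x₀ = bilinTrace (fderiv ℝ (fderiv ℝ φ) x₀) +
      (p - 2) * ⨆ ξ : sphere (0 : EucN N) 1, fderiv ℝ (fderiv ℝ φ) x₀ ξ ξ := by
  simp [domLap, hessQF, bilinTrace, iteratedFDeriv_two_apply]

lemma bilin_le_iSup (B : EucN N →L[ℝ] EucN N →L[ℝ] ℝ) {ξ : EucN N} (hξ : ‖ξ‖ = 1) :
    B ξ ξ ≤ ⨆ ξ : sphere (0 : EucN N) 1, B ξ ξ := by
  refine le_ciSup (f := fun ξ : sphere (0 : EucN N) 1 => B ξ ξ) ⟨‖B‖, ?_⟩ ⟨ξ, by simpa using hξ⟩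
  rintro _ ⟨ζ, rfl⟩
  have hζ : ‖(ζ : EucN N)‖ = 1 := by simp
  have h := (le_abs_self _).trans (B.le_opNorm₂ (ζ : EucN N) ζ)
  simpa [hζ] using h

lemma isViscSubsol_ubarF (hN : 2 ≤ N) {p q : ℝ} (hp : 2 ≤ p)
    (hq : q = ((N : ℝ) + 2) / ((N : ℝ) + p)) (hq0 : 0 ≤ q) (hq1 : q ≤ 1) {Ω : Set (EucN N)}
    (hΩ : IsOpen Ω) {F : EucN N → ℝ} {u : ℝ → EucN N → ℝ}
    (hu : ∀ ε : ℝ, 0 < ε → IsMVS q ε Ω F (u ε)) (hb : LocUnifBdd Ω u) :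
    IsViscSubsol p Ω (ubarF Ω u) := by
  intro x₀ hx₀ φ hφ hφx₀ hlt
  by_contra! hneg
  rw [domLap_eq] at hneg
  set B := fderiv ℝ (fderiv ℝ φ) x₀
  set Λ := ⨆ ξ : sphere (0 : EucN N) 1, B ξ ξ
  set d := -(bilinTrace B + (p - 2) * Λ) with hd
  have hd0 : 0 < d := by linarith
  have hNp : 0 < (N : ℝ) + p := by positivity
  set η := d / (2 * (N + p)) with hη
  have hη0 : 0 < η := by positivity
  have hηd : η * (N + p) = d / 2 := by rw [hη]; field_simp
  obtain ⟨r, hr, hrΩ, hT⟩ := exists_abs_sub_quadPoly_le hΩ hφ hx₀ (half_pos hη0)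
  set P := quadPoly x₀ (φ x₀) (fderiv ℝ φ x₀) (B + η • innerBilin) with hP
  have hPc : Continuous P := continuous_quadPoly _ _ _ _
  refine hb.not_touching hq0 hq1 hPc
    (fun ε hε x hx => (hu ε hε).integrableOn_ball hx) hr hrΩ ?_ (fun x hx hxx => ?_) fun ε hε => ?_
  · simp [hP, quadPoly, hφx₀]
  · refine (hlt x (hrΩ hx) hxx).trans_le ?_
    rw [hP, quadPoly_add_smul_innerBilin]
    linarith [(abs_le.mp (hT x hx)).2]
  · refine ⟨ε ^ 2 / (2 * (N + p)) * (d / 4), by positivity, fun x hx =>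
      (hu ε hε).sub_le_mveOp_sub hN hPc (subset_closure hx) (by positivity) fun ξ hξ => ?_⟩
    have hBξ : (B + η • innerBilin (N := N)) ξ ξ = B ξ ξ + η := by simp [hξ]
    rw [hP, mveOp_quadPoly hN hp hq hε, bilinTrace_add_smul_innerBilin, hBξ]
    have hle := mul_le_mul_of_nonneg_left (bilin_le_iSup B hξ) (sub_nonneg.mpr hp)
    have hfin : bilinTrace B + N * η + (p - 2) * (B ξ ξ + η) ≤ -(d / 2) := by linarith
    have := mul_le_mul_of_nonneg_left hfin (show 0 ≤ ε ^ 2 / (2 * (N + p)) by positivity)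
    linarith

lemma isViscSupersol_ulowF (hN : 2 ≤ N) {p q : ℝ} (hp : 2 ≤ p)
    (hq : q = ((N : ℝ) + 2) / ((N : ℝ) + p)) (hq0 : 0 ≤ q) (hq1 : q ≤ 1) {Ω : Set (EucN N)}
    (hΩ : IsOpen Ω) {F : EucN N → ℝ} {u : ℝ → EucN N → ℝ}
    (hu : ∀ ε : ℝ, 0 < ε → IsMVS q ε Ω F (u ε)) (hb : LocUnifBdd Ω u) :
    IsViscSupersol p Ω (ulowF Ω u) := by
  intro x₀ hx₀ φ hφ hφx₀ hlt
  by_contra! hpos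
  rw [domLap_eq] at hpos
  have hb' : LocUnifBdd Ω (fun ε y => -u ε y) := by simpa only [LocUnifBdd, abs_neg] using hb
  set B := fderiv ℝ (fderiv ℝ φ) x₀
  set Λ := ⨆ ξ : sphere (0 : EucN N) 1, B ξ ξ
  set d := bilinTrace B + (p - 2) * Λ with hd
  have hNp : 0 < (N : ℝ) + p := by positivity
  set η := d / (4 * (N + p)) with hη
  have hη0 : 0 < η := by positivity
  have hηd : η * (N + p) = d / 4 := by rw [hη]; field_simp
  obtain ⟨r, hr, hrΩ, hT⟩ := exists_abs_sub_quadPoly_le hΩ hφ hx₀ (half_pos hη0)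
  have := nonempty_unitSphere hN
  obtain ⟨⟨ξ, hξ⟩, hBξ⟩ := exists_lt_of_lt_ciSup (sub_lt_self Λ hη0)
  replace hξ : ‖ξ‖ = 1 := by simpa using hξ
  set P := quadPoly x₀ (-φ x₀) (-fderiv ℝ φ x₀) (-B + η • innerBilin) with hP
  have hPc : Continuous P := continuous_quadPoly _ _ _ _
  refine hb'.not_touching hq0 hq1 hPc (fun ε hε x hx => ((hu ε hε).integrableOn_ball hx).neg) hr
    hrΩ ?_ (fun x hx hxx => ?_) fun ε hε => ?_
  · rw [ulowF_eq_neg_ubarF] at hφx₀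
    simp [hP, quadPoly, hφx₀]
  · have h := hlt x (hrΩ hx) hxx
    rw [ulowF_eq_neg_ubarF] at h
    rw [hP, quadPoly_add_smul_innerBilin, quadPoly_neg]
    linarith [(abs_le.mp (hT x hx)).1]
  · refine ⟨ε ^ 2 / (2 * (N + p)) * (d / 4), by positivity, fun x hx => ⟨ξ, hξ,
      (hu ε hε).neg_sub_le_mveOp_neg_sub hε hq0 hq1 hPc (subset_closure hx) hξ ?_⟩⟩
    have hBη : (-B + η • innerBilin (N := N)) ξ ξ = -B ξ ξ + η := by simp [hξ]
    rw [hP, mveOp_quadPoly hN hp hq hε, bilinTrace_add_smul_innerBilin, bilinTrace_neg, hBη]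
    have hle := mul_le_mul_of_nonneg_left hBξ.le (sub_nonneg.mpr hp)
    have hfin : -bilinTrace B + N * η + (p - 2) * (-B ξ ξ + η) ≤ -(d / 4) := by
      nlinarith [show (0 : ℝ) ≤ N * η by positivity]
    have := mul_le_mul_of_nonneg_left hfin (show 0 ≤ ε ^ 2 / (2 * (N + p)) by positivity)
    linarith

/-- the upper half-relaxed limit `ū` of the ε-mean value solutions is a
viscosity subsolution, and the lower half-relaxed limit `u̲` is a viscosity
supersolution, of `D_p u = 0` in `Ω`. -/
theorem relaxed_limits_viscosity (hN : 2 ≤ N) (p q : ℝ) (hp : 2 ≤ p)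
    (hq : q = ((N : ℝ) + 2) / ((N : ℝ) + p))
    (Ω : Set (EucN N)) (hΩo : IsOpen Ω) (hΩb : Bornology.IsBounded Ω)
    (hΩc : IsConnected Ω) (δbar μ : ℝ) (hδbar : 0 < δbar) (hμ : μ ∈ Ioo (0 : ℝ) 1)
    (hΩlip : Corkscrew Ω δbar μ)
    (F : EucN N → ℝ) (K : ℝ≥0) (hF : LipschitzOnWith K F Ωᶜ)
    (u : ℝ → EucN N → ℝ) (hu : ∀ ε : ℝ, 0 < ε → IsMVS q ε Ω F (u ε)) :
    IsViscSubsol p Ω (ubarF Ω u) ∧ IsViscSupersol p Ω (ulowF Ω u) := by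
  have hNp : 0 < (N : ℝ) + p := by positivity
  have hq0 : 0 ≤ q := by rw [hq]; positivity
  have hq1 : q ≤ 1 := by rw [hq, div_le_one hNp]; linarith
  have hb : LocUnifBdd Ω u := by
    intro δ _
    obtain ⟨R, C, hRC⟩ := abs_le_on_Geps hΩb hΩc.nonempty hF δ
    exact ⟨C + R ^ 2, fun ε hε hεδ => (hu ε hε).abs_le_add_sq hN hp hq hq0 hq1 hε (hRC ε hεδ)⟩
  exact ⟨isViscSubsol_ubarF hN hp hq hq0 hq1 hΩo hu hb,
    isViscSupersol_ulowF hN hp hq hq0 hq1 hΩo hu hb⟩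

end
end
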